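/- The only triples (d, u, w) ∈ ℚ³ satisfying both (4d² − 4d + 1)w² − (d³ − 2d + 1)w + d³ − 2d² + d = 0 and (2d − 1)u² − (d³ + d² − d)u + d³ − d² = 0 are (d, u, w) ∈ {(1/2, 1, 1), (1, 0, 0), (1, 1, 0), (0, 0, 0), (0, 0, 1)}. -/

import Mathlib

@[ext] structure Cub (R : Type) where
  a : R
  b : R
  c : R

instance {R : Type} [DecidableEq R] : DecidableEq (Cub R) := fun x y =>
  decidable_of_iff (x.a = y.a ∧ x.b = y.b ∧ x.c = y.c) Cub.ext_iff.symm

namespace Cub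
variable {R : Type} [CommRing R]

instance : Zero (Cub R) := ⟨⟨0, 0, 0⟩⟩
instance : One (Cub R) := ⟨⟨1, 0, 0⟩⟩
instance : Add (Cub R) := ⟨fun x y => ⟨x.a + y.a, x.b + y.b, x.c + y.c⟩⟩
instance : Neg (Cub R) := ⟨fun x => ⟨-x.a, -x.b, -x.c⟩⟩
instance : Mul (Cub R) := ⟨fun x y =>
  ⟨x.a * y.a - 2 * (x.b * y.c + x.c * y.b) + 2 * (x.c * y.c),
   x.a * y.b + x.b * y.a - 4 * (x.b * y.c + x.c * y.b) + 2 * (x.c * y.c),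
   x.a * y.c + x.b * y.b + x.c * y.a - (x.b * y.c + x.c * y.b) - 3 * (x.c * y.c)⟩⟩

theorem zero_def : (0 : Cub R) = ⟨0, 0, 0⟩ := rfl
theorem one_def : (1 : Cub R) = ⟨1, 0, 0⟩ := rfl
theorem add_def (x y : Cub R) : x + y = ⟨x.a + y.a, x.b + y.b, x.c + y.c⟩ := rfl
theorem neg_def (x : Cub R) : -x = ⟨-x.a, -x.b, -x.c⟩ := rfl
theorem mul_def (x y : Cub R) : x * y =
  ⟨x.a * y.a - 2 * (x.b * y.c + x.c * y.b) + 2 * (x.c * y.c),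
   x.a * y.b + x.b * y.a - 4 * (x.b * y.c + x.c * y.b) + 2 * (x.c * y.c),
   x.a * y.c + x.b * y.b + x.c * y.a - (x.b * y.c + x.c * y.b) - 3 * (x.c * y.c)⟩ := rfl

instance : CommRing (Cub R) where
  add_assoc x y z := by ext <;> simp [add_def] <;> ring
  zero_add x := by ext <;> simp [add_def, zero_def]
  add_zero x := by ext <;> simp [add_def, zero_def]
  add_comm x y := by ext <;> simp [add_def] <;> ring
  mul_assoc x y z := by ext <;> simp [mul_def] <;> ring
  one_mul x := by ext <;> simp [mul_def, one_def]
  mul_one x := by ext <;> simp [mul_def, one_def]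
  mul_comm x y := by ext <;> simp [mul_def] <;> ring
  left_distrib x y z := by ext <;> simp [mul_def, add_def] <;> ring
  right_distrib x y z := by ext <;> simp [mul_def, add_def] <;> ring
  zero_mul x := by ext <;> simp [mul_def, zero_def]
  mul_zero x := by ext <;> simp [mul_def, zero_def]
  neg_add_cancel x := by ext <;> simp [neg_def, add_def, zero_def]
  nsmul := nsmulRec
  zsmul := zsmulRec

/-- the norm form -/
def norm (x : Cub R) : R :=
  x.a ^ 3 - x.a ^ 2 * x.b - 7 * x.a ^ 2 * x.c + 4 * x.a * x.b ^ 2 + 2 * x.a * x.b * x.c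
    + 12 * x.a * x.c ^ 2 - 2 * x.b ^ 3 + 2 * x.b ^ 2 * x.c - 8 * x.b * x.c ^ 2 + 4 * x.c ^ 3

/-- the adjoint -/
def adj (x : Cub R) : Cub R :=
  ⟨x.a ^ 2 - x.a * x.b - 7 * x.a * x.c + 4 * x.b ^ 2 - 2 * x.b * x.c + 14 * x.c ^ 2,
   -x.a * x.b + x.b ^ 2 - x.b * x.c + 2 * x.c ^ 2 ,
   -x.a * x.c + x.b ^ 2 - x.b * x.c + 4 * x.c ^ 2⟩

theorem norm_mul (x y : Cub R) : norm (x * y) = norm x * norm y := by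
  simp only [norm, mul_def]; ring

theorem mul_adj (x : Cub R) : x * adj x = ⟨norm x, 0, 0⟩ := by
  ext <;> simp [mul_def, adj, norm] <;> ring

end Cub

open MeasureTheory in
theorem minkowski3 (A : Matrix (Fin 3) (Fin 3) ℝ) (h0 : A.det ≠ 0) (h1 : A.det ^ 2 ≤ 212) :
    ∃ k : Fin 3 → ℤ, k ≠ 0 ∧
      ∑ i, (A.mulVec (fun j => (k j : ℝ)) i) ^ 2 < 9.2 := by
  classical
  set T : (Fin 3 → ℝ) →ₗ[ℝ] (Fin 3 → ℝ) := Matrix.toLin' A with hT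
  have hdet : LinearMap.det T = A.det := by simp [hT]
  set W : (Fin 3 → ℝ) →ₗ[ℝ] EuclideanSpace ℝ (Fin 3) :=
    (WithLp.linearEquiv 2 ℝ (Fin 3 → ℝ)).symm.toLinearMap with hW
  set Bset : Set (Fin 3 → ℝ) := (@WithLp.toLp 2 (Fin 3 → ℝ)) ⁻¹'
    (Metric.ball (0 : EuclideanSpace ℝ (Fin 3)) (Real.sqrt 9.2)) with hB
  have hBW : Bset = W ⁻¹' (Metric.ball (0 : EuclideanSpace ℝ (Fin 3)) (Real.sqrt 9.2)) := rfl
  have hvolB : volume Bset = .ofReal (Real.sqrt 9.2) ^ 3 * .ofReal (Real.pi * 4 / 3) := by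
    rw [hB, (PiLp.volume_preserving_toLp (Fin 3)).measure_preimage
      measurableSet_ball.nullMeasurableSet, EuclideanSpace.volume_ball_fin_three]
  set S := T ⁻¹' Bset with hS
  have hvolS : volume S = ENNReal.ofReal |(A.det)⁻¹| * volume Bset := by
    rw [hS, Measure.addHaar_preimage_linearMap _ (by rw [hdet]; exact h0), hdet]
  have hconv : Convex ℝ S := by
    rw [hS, hBW]
    exact ((convex_ball _ _).linear_preimage W).linear_preimage T
  have hsymm : ∀ x ∈ S, -x ∈ S := by
    intro x hx
    simp only [hS, hBW, Set.mem_preimage, map_neg, mem_ball_zero_iff, norm_neg] at hx ⊢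
    exact hx
  have hfund := ZSpan.isAddFundamentalDomain' (Pi.basisFun ℝ (Fin 3)) volume
  have hlt : volume (ZSpan.fundamentalDomain (Pi.basisFun ℝ (Fin 3))) *
      2 ^ Module.finrank ℝ (Fin 3 → ℝ) < volume S := by
    have e1 : volume (ZSpan.fundamentalDomain (Pi.basisFun ℝ (Fin 3))) = 1 := by
      rw [ZSpan.fundamentalDomain_pi_basisFun, volume_pi, Measure.pi_pi]
      simp
    rw [e1, hvolS, hvolB, Module.finrank_fin_fun, one_mul,
      ← ENNReal.ofReal_pow (by positivity), ← ENNReal.ofReal_mul (by positivity),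
      ← ENNReal.ofReal_mul (by positivity)]
    have : (2 : ENNReal) ^ 3 = ENNReal.ofReal 8 := by norm_num
    rw [this]
    apply (ENNReal.ofReal_lt_ofReal_iff_of_nonneg (by norm_num)).2
    rw [abs_inv]
    have hd : 0 < |A.det| := abs_pos.2 h0
    rw [inv_mul_eq_div, lt_div_iff₀ hd]
    have hpi := Real.pi_gt_d4
    have hs : Real.sqrt 9.2 ^ 2 = 9.2 := Real.sq_sqrt (by norm_num)
    apply lt_of_pow_lt_pow_left₀ 2 (by positivity)
    have e2 : (Real.sqrt 9.2 ^ 3 * (Real.pi * 4 / 3)) ^ 2 =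
      (Real.sqrt 9.2 ^ 2) ^ 3 * (Real.pi ^ 2 * 16 / 9) := by ring
    rw [e2, hs, mul_pow, sq_abs]
    nlinarith
  have : Countable (Submodule.span ℤ (Set.range (Pi.basisFun ℝ (Fin 3)))).toAddSubgroup :=
    inferInstanceAs (Countable (Submodule.span ℤ (Set.range (Pi.basisFun ℝ (Fin 3)))))
  obtain ⟨x, hx0, hxS⟩ := exists_ne_zero_mem_lattice_of_measure_mul_two_pow_lt_measure hfund
    hsymm hconv hlt
  have hx := x.2
  have hx' : (x : Fin 3 → ℝ) ∈ Submodule.span ℤ (Set.range (Pi.basisFun ℝ (Fin 3))) := hx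
  rw [Module.Basis.mem_span_iff_repr_mem] at hx'
  choose k hk using hx'
  have hk' : (x : Fin 3 → ℝ) = fun j => (k j : ℝ) := by
    ext j; have := hk j; simp at this; exact this.symm
  refine ⟨k, ?_, ?_⟩
  · rintro rfl
    apply hx0
    apply Subtype.ext
    rw [hk']; ext; simp
  · rw [hS, hB, Set.mem_preimage, Set.mem_preimage, mem_ball_zero_iff, EuclideanSpace.norm_eq] at hxS
    have := (Real.sqrt_lt_sqrt_iff (by positivity)).1 hxS
    rw [hk'] at this
    simpa [hT, Matrix.toLin'_apply, sq_abs] using this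

namespace Cub

/-- real embedding -/
noncomputable def ev (r : ℝ) (x : Cub ℤ) : ℝ := x.a + x.b * r + x.c * r ^ 2
/-- real part of the complex embedding -/
noncomputable def rp (r t : ℝ) (x : Cub ℤ) : ℝ :=
  x.a - (1 + r) / 2 * x.b + ((1 + r) ^ 2 / 4 - t ^ 2) * x.c
/-- imaginary part of the complex embedding -/
noncomputable def ip (r t : ℝ) (x : Cub ℤ) : ℝ := t * (x.b - (1 + r) * x.c)

theorem exists_root : ∃ r t : ℝ, r ^ 3 + r ^ 2 + 4 * r + 2 = 0 ∧ -0.5332 < r ∧ r < -0.5331 ∧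
    1.9226 < t ∧ t < 1.9228 ∧ t ^ 2 = 4 + r + r ^ 2 - (1 + r) ^ 2 / 4 := by
  have hc : ContinuousOn (fun x : ℝ => x ^ 3 + x ^ 2 + 4 * x + 2) (Set.Icc (-0.5332) (-0.5331)) := by
    fun_prop
  obtain ⟨r, ⟨h1, h2⟩, h3⟩ := intermediate_value_Ioo (by norm_num) hc
    (show (0 : ℝ) ∈ Set.Ioo _ _ by constructor <;> norm_num)
  have hp : 0 ≤ 4 + r + r ^ 2 - (1 + r) ^ 2 / 4 := by nlinarith
  have hs := Real.sq_sqrt hp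
  refine ⟨r, Real.sqrt (4 + r + r ^ 2 - (1 + r) ^ 2 / 4), h3, h1, h2, ?_, ?_, hs⟩
  · apply Real.lt_sqrt_of_sq_lt; nlinarith
  · rw [Real.sqrt_lt' (by norm_num)]; nlinarith

section
variable {r t : ℝ} (hr : r ^ 3 + r ^ 2 + 4 * r + 2 = 0)
  (ht : t ^ 2 = 4 + r + r ^ 2 - (1 + r) ^ 2 / 4)

theorem ev_mul (hr : r ^ 3 + r ^ 2 + 4 * r + 2 = 0) (x y : Cub ℤ) :
    ev r (x * y) = ev r x * ev r y := by
  simp only [ev, mul_def]; push_cast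
  linear_combination (-(x.b * y.c + x.c * y.b : ℝ) - (x.c * y.c : ℝ) * (r - 1)) * hr

theorem ip_mul (hr : r ^ 3 + r ^ 2 + 4 * r + 2 = 0)
    (ht : t ^ 2 = 4 + r + r ^ 2 - (1 + r) ^ 2 / 4) (x y : Cub ℤ) :
    ip r t (x * y) = rp r t x * ip r t y + ip r t x * rp r t y := by
  simp only [rp, ip, mul_def]; push_cast
  rw [ht]
  linear_combination (- (x.c * y.c : ℝ) * t) * hr

theorem rp_mul (hr : r ^ 3 + r ^ 2 + 4 * r + 2 = 0)
    (ht : t ^ 2 = 4 + r + r ^ 2 - (1 + r) ^ 2 / 4) (x y : Cub ℤ) :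
    rp r t (x * y) = rp r t x * rp r t y - ip r t x * ip r t y := by
  simp only [rp, ip, mul_def]; push_cast
  rw [show (t * (x.b - (1 + r) * x.c) * (t * (y.b - (1 + r) * y.c)) : ℝ)
    = t ^ 2 * ((x.b - (1 + r) * x.c) * ((y.b - (1 + r) * y.c))) by ring, ht]
  linear_combination ((x.c * y.c : ℝ) * (r / 2 + 3 / 2) - (x.b * y.c + x.c * y.b : ℝ)) * hr

theorem norm_ev (hr : r ^ 3 + r ^ 2 + 4 * r + 2 = 0)
    (ht : t ^ 2 = 4 + r + r ^ 2 - (1 + r) ^ 2 / 4) (x : Cub ℤ) :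
    ((norm x : ℤ) : ℝ) = ev r x * (rp r t x ^ 2 + ip r t x ^ 2) := by
  simp only [rp, ip, ev, norm]; push_cast
  rw [mul_pow, ht]
  linear_combination (3 * x.a * x.b * x.c - 2 * x.a * x.c ^ 2 - 4 * x.b * x.c ^ 2 + x.b ^ 2 * x.c - x.b ^ 3
    - x.c ^ 3 * (r ^ 3 + r ^ 2 + 4 * r - 2) : ℝ) * hr
end

/-- Minkowski step. -/
theorem exists_short {r t : ℝ} (hr : r ^ 3 + r ^ 2 + 4 * r + 2 = 0)
    (ht : t ^ 2 = 4 + r + r ^ 2 - (1 + r) ^ 2 / 4)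
    (M A B : Cub ℤ) (v ρ : ℤ) (hv : v ≠ 0) (hA : M * A = ⟨v ^ 2, 0, 0⟩) (hB : M * B = ⟨-ρ, 1, 0⟩)
    (hM : 0 < ev r M) (hN : norm M = v ^ 2) :
    ∃ ξ η : Cub ℤ, ξ ≠ 0 ∧ ξ * ξ = M * η ∧
      ev r η + 2 * Real.sqrt (rp r t η ^ 2 + ip r t η ^ 2) < 9.2 := by
  set m := Real.sqrt (rp r t M ^ 2 + ip r t M ^ 2) with hm
  have hm2 : m ^ 2 = rp r t M ^ 2 + ip r t M ^ 2 := Real.sq_sqrt (by positivity)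
  have hvR : (v : ℝ) ≠ 0 := by exact_mod_cast hv
  have hNM : ev r M * m ^ 2 = (v : ℝ) ^ 2 := by
    rw [hm2, ← norm_ev hr ht, hN]; push_cast; ring
  have hm0 : 0 < m := by
    rcases (Real.sqrt_nonneg (rp r t M ^ 2 + ip r t M ^ 2)).lt_or_eq with h | h
    · exact h
    · exfalso; rw [← hm] at h; rw [← h] at hNM; apply hvR; nlinarith
  set s1 := (Real.sqrt (ev r M))⁻¹ with hs1
  set s2 := Real.sqrt (2 / m) with hs2
  have hs1' : s1 ^ 2 = (ev r M)⁻¹ := by rw [hs1, inv_pow, Real.sq_sqrt hM.le]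
  have hs2' : s2 ^ 2 = 2 / m := Real.sq_sqrt (by positivity)
  let Q : Matrix (Fin 3) (Fin 3) ℝ :=
    !![s1 * v, s1 * (r - ρ), s1 * (r ^ 2 - ρ ^ 2);
       s2 * v, s2 * (-(1 + r) / 2 - ρ), s2 * ((1 + r) ^ 2 / 4 - t ^ 2 - ρ ^ 2);
       0, s2 * t, s2 * (-(1 + r) * t)]
  have hdet : Q.det ^ 2 = 212 := by
    have e1 : Q.det = s1 * s2 ^ 2 * v * (t * ((r + (1 + r) / 2) ^ 2 + t ^ 2)) := by
      simp only [Q, Matrix.det_fin_three]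
      simp
      ring
    have e2 : (t * ((r + (1 + r) / 2) ^ 2 + t ^ 2)) ^ 2 = 53 := by
      rw [show (t * ((r + (1 + r) / 2) ^ 2 + t ^ 2)) ^ 2
        = t ^ 2 * ((r + (1 + r) / 2) ^ 2 + t ^ 2) ^ 2 by ring, ht]
      linear_combination (27 / 4 * r ^ 3 + 27 / 4 * r ^ 2 + 27 * r + 7 / 2) * hr
    rw [e1, mul_pow, e2, mul_pow, mul_pow, hs1', hs2', ← hNM]
    field_simp
    norm_num
  obtain ⟨k, hk0, hk⟩ := minkowski3 Q (by intro h; rw [h] at hdet; norm_num at hdet) hdet.le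
  let ξ : Cub ℤ := ⟨v * k 0 - ρ * k 1 - ρ ^ 2 * k 2, k 1, k 2⟩
  let C : Cub ℤ := ⟨k 1 + ρ * k 2, k 2, 0⟩
  have hξ : ξ = ⟨v * k 0, 0, 0⟩ + ⟨-ρ, 1, 0⟩ * C := by
    ext <;> simp [ξ, C, add_def, mul_def] <;> ring
  let η : Cub ℤ := A * ⟨k 0 ^ 2, 0, 0⟩ + ⟨2 * v * k 0, 0, 0⟩ * B * C + M * B * B * C * C
  have hξη : ξ * ξ = M * η := by
    have e : M * η = (M * A) * ⟨k 0 ^ 2, 0, 0⟩ + ⟨2 * v * k 0, 0, 0⟩ * (M * B) * C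
        + (M * B) * (M * B) * C * C := by simp only [η]; ring
    rw [e, hA, hB, hξ]
    have f1 : (⟨v * k 0, 0, 0⟩ : Cub ℤ) * ⟨v * k 0, 0, 0⟩ = ⟨v ^ 2, 0, 0⟩ * ⟨k 0 ^ 2, 0, 0⟩ := by
      ext <;> simp [mul_def] <;> ring
    have f2 : (⟨2 * v * k 0, 0, 0⟩ : Cub ℤ) = 2 * ⟨v * k 0, 0, 0⟩ := by
      rw [two_mul (⟨v * k 0, 0, 0⟩ : Cub ℤ)]; ext <;> simp [add_def] <;> ring
    rw [f2, ← f1]; ring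
  refine ⟨ξ, η, ?_, hξη, ?_⟩
  · intro h
    apply hk0
    have h1 : k 1 = 0 := congrArg Cub.b h
    have h2 : k 2 = 0 := congrArg Cub.c h
    have h3 : v * k 0 - ρ * k 1 - ρ ^ 2 * k 2 = 0 := congrArg Cub.a h
    rw [h1, h2] at h3
    have h4 : k 0 = 0 := by simpa [hv] using h3
    ext i; fin_cases i <;> simp [h1, h2, h4]
  · have g1 : ev r ξ ^ 2 = ev r M * ev r η := by
      rw [← ev_mul hr, ← hξη, ev_mul hr]; ring
    have g2 : rp r t ξ ^ 2 + ip r t ξ ^ 2 = m * Real.sqrt (rp r t η ^ 2 + ip r t η ^ 2) := by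
      rw [hm, ← Real.sqrt_mul (by positivity)]
      have : (rp r t M ^ 2 + ip r t M ^ 2) * (rp r t η ^ 2 + ip r t η ^ 2)
          = (rp r t ξ ^ 2 + ip r t ξ ^ 2) ^ 2 := by
        have i1 := ip_mul hr ht M η
        have i2 := rp_mul hr ht M η
        rw [← hξη, ip_mul hr ht] at i1
        rw [← hξη, rp_mul hr ht] at i2
        have : (rp r t M ^ 2 + ip r t M ^ 2) * (rp r t η ^ 2 + ip r t η ^ 2)
          = (rp r t M * ip r t η + ip r t M * rp r t η) ^ 2
            + (rp r t M * rp r t η - ip r t M * ip r t η) ^ 2 := by ring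
        rw [this, ← i1, ← i2]; ring
      rw [this, Real.sqrt_sq (by positivity)]
    have hq : ∑ i, (Q.mulVec (fun j => (k j : ℝ)) i) ^ 2
        = s1 ^ 2 * ev r ξ ^ 2 + s2 ^ 2 * (rp r t ξ ^ 2 + ip r t ξ ^ 2) := by
      simp [Fin.sum_univ_three, Q, Matrix.mulVec, dotProduct, ev, rp, ip, ξ]
      ring
    rw [hq, g1, g2, hs1', hs2'] at hk
    have : (ev r M)⁻¹ * (ev r M * ev r η) + 2 / m * (m * Real.sqrt (rp r t η ^ 2 + ip r t η ^ 2))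
      = ev r η + 2 * Real.sqrt (rp r t η ^ 2 + ip r t η ^ 2) := by
      field_simp
    rw [this] at hk
    exact hk
end Cub

namespace Cub

theorem box {r t : ℝ} (hr1 : -0.5332 < r) (hr2 : r < -0.5331) (ht1 : 1.9226 < t)
    (η : Cub ℤ) (y : ℝ) (hx : 0 ≤ ev r η) (hy0 : 0 ≤ y) (hre : |rp r t η| ≤ y)
    (him : |ip r t η| ≤ y) (h : ev r η + 2 * y < 9.2) :
    (-2 ≤ η.c ∧ η.c ≤ 2) ∧ (-3 ≤ η.b ∧ η.b ≤ 3) ∧ (-11 ≤ η.a ∧ η.a ≤ 11) := by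
  obtain ⟨a, b, c⟩ := η
  simp only [ev, rp, ip] at *
  set q : ℝ := b - (1 + r) * c with hq
  have hbq : (b : ℝ) = q + (1 + r) * c := by rw [hq]; ring
  have hqy : |q| * 1.9226 ≤ y := by
    rw [abs_mul, abs_of_pos (by linarith)] at him
    nlinarith [abs_nonneg q]
  obtain ⟨q1, q2⟩ := abs_le.1 (show |q| ≤ y / 1.9226 by rw [le_div_iff₀ (by norm_num)]; exact hqy)
  obtain ⟨p1, p2⟩ := abs_le.1 hre
  have ht2 : 3.69 < t ^ 2 := by nlinarith
  have hK : (c : ℝ) * ((r + (1 + r) / 2) ^ 2 + t ^ 2) = (a + b * r + c * r ^ 2)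
      - (a - (1 + r) / 2 * b + ((1 + r) ^ 2 / 4 - t ^ 2) * c) - (r + (1 + r) / 2) * q := by
    rw [hq]; ring
  have hKl : 3.78 ≤ (r + (1 + r) / 2) ^ 2 + t ^ 2 := by
    have h5 : 0.2996 ≤ -(r + (1 + r) / 2) := by linarith
    have : 0.2996 ^ 2 ≤ (-(r + (1 + r) / 2)) ^ 2 := pow_le_pow_left₀ (by norm_num) h5 2
    have h6 : 1.9226 ^ 2 ≤ t ^ 2 := pow_le_pow_left₀ (by norm_num) ht1.le 2
    rw [neg_sq] at this
    linarith
  have hzq : |(r + (1 + r) / 2) * q| ≤ 0.31 * (y / 1.9226) := by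
    rw [abs_mul]
    exact mul_le_mul (abs_le.2 ⟨by linarith, by linarith⟩) (abs_le.2 ⟨q1, q2⟩) (abs_nonneg _)
      (by norm_num)
  obtain ⟨z1, z2⟩ := abs_le.1 hzq
  have hyq : y / 1.9226 ≤ y := div_le_self hy0 (by norm_num)
  have hyq0 : 0 ≤ y / 1.9226 := by positivity
  have hyq2 : y / 1.9226 * 1.9226 = y := by field_simp
  generalize y / 1.9226 = yq at *
  set K := (r + (1 + r) / 2) ^ 2 + t ^ 2 with hKdef
  set Z := (r + (1 + r) / 2) * q with hZ
  set X := (a + b * r + c * r ^ 2 : ℝ) with hX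
  set Y := (a - (1 + r) / 2 * b + ((1 + r) ^ 2 / 4 - t ^ 2) * c : ℝ) with hY
  clear_value K Z X Y
  have hc : -2 ≤ c ∧ c ≤ 2 := by
    constructor
    · by_contra hc
      have h3 : (3 : ℝ) ≤ -c := by exact_mod_cast (by omega : 3 ≤ -c)
      have : 3 * 3.78 ≤ (-c : ℝ) * K := mul_le_mul h3 hKl (by norm_num) (by linarith)
      norm_num at *
      linarith
    · by_contra hc
      have h3 : (3 : ℝ) ≤ c := by exact_mod_cast (by omega : 3 ≤ c)
      have : 3 * 3.78 ≤ (c : ℝ) * K := mul_le_mul h3 hKl (by norm_num) (by linarith)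
      norm_num at *
      linarith
  have hcR1 : (-2 : ℝ) ≤ c := by exact_mod_cast hc.1
  have hcR2 : (c : ℝ) ≤ 2 := by exact_mod_cast hc.2
  have hrc : |(1 + r) * (c : ℝ)| ≤ 0.47 * 2 := by
    rw [abs_mul]
    exact mul_le_mul (abs_le.2 ⟨by linarith, by linarith⟩) (abs_le.2 ⟨hcR1, hcR2⟩) (abs_nonneg _)
      (by norm_num)
  obtain ⟨w1, w2⟩ := abs_le.1 hrc
  have hb : -3 ≤ b ∧ b ≤ 3 := by
    constructor
    · by_contra hb
      have : (b : ℝ) ≤ -4 := by exact_mod_cast (by omega : b ≤ -4)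
      linarith
    · by_contra hb
      have : (4 : ℝ) ≤ b := by exact_mod_cast (by omega : 4 ≤ b)
      linarith
  have hbR1 : (-3 : ℝ) ≤ b := by exact_mod_cast hb.1
  have hbR2 : (b : ℝ) ≤ 3 := by exact_mod_cast hb.2
  have e1 : |(b : ℝ) * r| ≤ 3 * 0.5332 := by
    rw [abs_mul]; exact mul_le_mul (abs_le.2 ⟨hbR1, hbR2⟩) (abs_le.2 ⟨by linarith, by linarith⟩)
      (abs_nonneg _) (by norm_num)
  have e2 : |(c : ℝ) * r ^ 2| ≤ 2 * 0.5332 ^ 2 := by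
    rw [abs_mul]
    exact mul_le_mul (abs_le.2 ⟨hcR1, hcR2⟩) (by rw [abs_pow]; gcongr; exact (abs_le.2 ⟨by linarith, by linarith⟩))
      (abs_nonneg _) (by norm_num)
  obtain ⟨e11, e12⟩ := abs_le.1 e1
  obtain ⟨e21, e22⟩ := abs_le.1 e2
  refine ⟨hc, hb, ?_, ?_⟩
  · by_contra ha
    have : (a : ℝ) ≤ -12 := by exact_mod_cast (by omega : a ≤ -12)
    linarith
  · by_contra ha
    have : (12 : ℝ) ≤ a := by exact_mod_cast (by omega : 12 ≤ a)
    linarith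

/-- The possible values. -/
def good (x : Cub ℤ) : Prop :=
  x = ⟨0,0,0⟩ ∨ x = ⟨1,-1,1⟩ ∨
  (x = ⟨0,-1,-1⟩ ∨ x = ⟨0,-2,0⟩ ∨ x = ⟨4,1,1⟩ ∨ x = ⟨0,-1,1⟩) ∨
  (x = ⟨1,0,0⟩ ∨ x = ⟨0,0,1⟩ ∨ x = ⟨1,2,1⟩ ∨ x = ⟨7,0,2⟩) ∨
  (x = ⟨-1,-2,0⟩ ∨ x = ⟨3,0,1⟩ ∨ x = ⟨4,0,1⟩ ∨ x = ⟨2,2,1⟩ ∨ x = ⟨1,0,-1⟩ ∨ x = ⟨2,2,0⟩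
    ∨ x = ⟨1,2,2⟩)

set_option maxRecDepth 100000 in
set_option maxHeartbeats 4000000 in
theorem enum_aux : ∀ c ∈ Finset.Icc (-2 : ℤ) 2, ∀ b ∈ Finset.Icc (-3 : ℤ) 3,
    ∀ a ∈ Finset.Icc (-11 : ℤ) 11,
    (norm (⟨a, b, c⟩ : Cub ℤ) ∈ [0, 1, 4, 9, 16, 25]) →
    (a, b, c) ∈ [((0 : ℤ), (0 : ℤ), (0 : ℤ)), (1,-1,1), (0,-1,-1), (0,-2,0), (4,1,1), (0,-1,1),
      (1,0,0), (0,0,1), (1,2,1), (7,0,2), (-1,-2,0), (3,0,1), (4,0,1), (2,2,1), (1,0,-1), (2,2,0),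
      (1,2,2)] := by
  unfold norm
  decide

theorem enum (x : Cub ℤ) (h : (-2 ≤ x.c ∧ x.c ≤ 2) ∧ (-3 ≤ x.b ∧ x.b ≤ 3) ∧ (-11 ≤ x.a ∧ x.a ≤ 11))
    (hn : norm x ∈ [0, 1, 4, 9, 16, 25]) : good x := by
  obtain ⟨a, b, c⟩ := x
  have := enum_aux c (Finset.mem_Icc.2 h.1) b (Finset.mem_Icc.2 h.2.1) a (Finset.mem_Icc.2 h.2.2) hn
  clear h hn
  simp only [List.mem_cons, Prod.mk.injEq, List.not_mem_nil, or_false] at this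
  unfold good
  rcases this with h | h | h | h | h | h | h | h | h | h | h | h | h | h | h | h | h <;>
    obtain ⟨rfl, rfl, rfl⟩ := h <;> simp

theorem parity (M ξ η : Cub ℤ) (hM : M.a % 2 = 1) (h : ξ * ξ = M * η)
    (hη : η = ⟨0,-1,-1⟩ ∨ η = ⟨0,-2,0⟩ ∨ η = ⟨4,1,1⟩ ∨ η = ⟨0,-1,1⟩) : False := by
  obtain ⟨a, b, c⟩ := M
  obtain ⟨x, y, z⟩ := ξ
  simp only at hM
  obtain ⟨a', rfl⟩ : ∃ k, a = 2 * k + 1 := ⟨a / 2, by omega⟩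
  rcases hη with rfl | rfl | rfl | rfl <;> simp only [mul_def, Cub.mk.injEq] at h <;>
    obtain ⟨h1, h2, h3⟩ := h
  all_goals
    have hx : x % 2 = 0 := by
      by_contra hx
      obtain ⟨x', rfl⟩ : ∃ k, x = 2 * k + 1 := ⟨x / 2, by omega⟩
      ring_nf at h1
      omega
    obtain ⟨x', rfl⟩ : ∃ k, x = 2 * k := ⟨x / 2, by omega⟩
    ring_nf at h1 h2 h3
    omega

end Cub

namespace Cub

theorem eq_zero_of_sq {r t : ℝ} (hr : r ^ 3 + r ^ 2 + 4 * r + 2 = 0) (ht0 : 0 < t)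
    (ht : t ^ 2 = 4 + r + r ^ 2 - (1 + r) ^ 2 / 4) (x : Cub ℤ) (h : x * x = 0) : x = 0 := by
  have h1 : ev r x = 0 := by
    have := ev_mul hr x x
    rw [h] at this
    have e : ev r 0 = 0 := by simp [ev, zero_def]
    rw [e] at this
    nlinarith
  have hi := ip_mul hr ht x x
  have hp := rp_mul hr ht x x
  rw [h] at hi hp
  have ei : ip r t 0 = 0 := by simp [ip, zero_def]
  have ep : rp r t 0 = 0 := by simp [rp, zero_def]
  rw [ei] at hi
  rw [ep] at hp
  have hi0 : rp r t x = 0 ∧ ip r t x = 0 := by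
    have : rp r t x * ip r t x = 0 := by linarith
    rcases mul_eq_zero.1 this with h | h
    · refine ⟨h, ?_⟩; rw [h] at hp; nlinarith
    · refine ⟨?_, h⟩; rw [h] at hp; nlinarith
  obtain ⟨h2, h3⟩ := hi0
  obtain ⟨a, b, c⟩ := x
  simp only [ev, rp, ip] at h1 h2 h3
  have hq : (b : ℝ) = (1 + r) * c := by
    rcases mul_eq_zero.1 h3 with h | h <;> linarith
  rw [hq] at h1 h2
  have hc : (c : ℝ) * ((r + (1 + r) / 2) ^ 2 + t ^ 2) = 0 := by linear_combination h1 - h2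
  have hc0 : (c : ℝ) = 0 := by
    rcases mul_eq_zero.1 hc with h | h
    · exact h
    · exfalso; have : 0 < (r + (1 + r) / 2) ^ 2 + t ^ 2 := by positivity
      linarith
  rw [hc0] at hq h1
  simp at hq h1
  have : c = 0 := by exact_mod_cast hc0
  ext <;> simp [*, zero_def]

theorem core (M A B : Cub ℤ) (v ρ : ℤ) (hv : v ≠ 0) (hA : M * A = ⟨v ^ 2, 0, 0⟩)
    (hB : M * B = ⟨-ρ, 1, 0⟩) (hN : norm M = v ^ 2) (hM : M.a % 2 = 1) :
    ∃ ξ s : Cub ℤ, norm s ≠ 0 ∧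
      (M * (s * s) = ξ * ξ ∨ M * (s * s) = ⟨-1, -2, 0⟩ * (ξ * ξ)) := by
  obtain ⟨r, t, hr, hr1, hr2, ht1, ht2, ht⟩ := exists_root
  have hvp : (0 : ℝ) < (v : ℝ) ^ 2 := by positivity
  have hNr := norm_ev hr ht M
  rw [hN] at hNr; push_cast at hNr
  have hMp : 0 < ev r M := by
    by_contra h
    have : ev r M * (rp r t M ^ 2 + ip r t M ^ 2) ≤ 0 :=
      mul_nonpos_of_nonpos_of_nonneg (not_lt.1 h) (by positivity)
    linarith
  obtain ⟨ξ, η, hξ0, h, hlt⟩ := exists_short hr ht M A B v ρ hv hA hB hMp hN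
  set y := Real.sqrt (rp r t η ^ 2 + ip r t η ^ 2) with hy
  have hy0 : 0 ≤ y := Real.sqrt_nonneg _
  have hy2 : y ^ 2 = rp r t η ^ 2 + ip r t η ^ 2 := Real.sq_sqrt (by positivity)
  have hx : 0 ≤ ev r η := by
    have g1 : ev r ξ ^ 2 = ev r M * ev r η := by rw [← ev_mul hr, ← h, ev_mul hr]; ring
    by_contra hneg
    have := mul_neg_of_pos_of_neg hMp (not_le.1 hneg)
    nlinarith [sq_nonneg (ev r ξ)]
  have hbox := box hr1 hr2 ht1 η y hx hy0 (abs_le_of_sq_le_sq (by nlinarith [sq_nonneg (ip r t η)]) hy0)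
    (abs_le_of_sq_le_sq (by nlinarith [sq_nonneg (rp r t η)]) hy0) hlt
  have hnη : ((norm η : ℤ) : ℝ) = ev r η * y ^ 2 := by rw [norm_ev hr ht, hy2]
  have hn0 : 0 ≤ norm η := by
    have : (0 : ℝ) ≤ ((norm η : ℤ) : ℝ) := by rw [hnη]; positivity
    exact_mod_cast this
  have hn28 : norm η < 29 := by
    have : ((norm η : ℤ) : ℝ) < 29 := by
      rw [hnη]
      have h1 : ev r η * y ^ 2 ≤ (9.2 - 2 * y) * y ^ 2 :=
        mul_le_mul_of_nonneg_right (by linarith) (by positivity)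
      have h2 : 0 ≤ (2 * y + 3.0667) * (y - 3.0667) ^ 2 := by positivity
      nlinarith
    exact_mod_cast this
  have hsq : norm ξ ^ 2 = v ^ 2 * norm η := by
    have := congrArg norm h
    rw [norm_mul, norm_mul, hN] at this
    rw [← this]; ring
  have hdvd : v ∣ norm ξ := by
    rw [← Int.pow_dvd_pow_iff (n := 2) (by norm_num)]
    exact ⟨_, hsq⟩
  obtain ⟨k, hk⟩ := hdvd
  have hk2 : norm η = k ^ 2 := by
    have hv2 : v ^ 2 ≠ 0 := pow_ne_zero _ hv
    apply mul_left_cancel₀ hv2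
    rw [← hsq, hk]; ring
  have hmem : norm η ∈ [0, 1, 4, 9, 16, 25] := by
    rw [hk2] at hn28 ⊢
    have h1 : k ≤ 5 := by nlinarith
    have h2 : -5 ≤ k := by nlinarith
    interval_cases k <;> simp
  have hgood := enum η hbox hmem
  rcases hgood with h0 | hbad | hpar | hs | hs
  · exfalso
    apply hξ0
    apply eq_zero_of_sq hr (by linarith) ht
    rw [h, h0]
    change M * 0 = 0
    simp
  · exfalso
    have hn : norm η = 25 := by rw [hbad]; norm_num [norm]
    have he : ev r η = 1 - r + r ^ 2 := by rw [hbad]; simp [ev]; ring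
    rw [hn, he] at hnη
    rw [he] at hlt
    have x1 : 1.8172 ≤ 1 - r + r ^ 2 := by nlinarith
    have x2 : 1 - r + r ^ 2 ≤ 1.8176 := by nlinarith
    have y1 : y ≤ 3.6914 := by linarith
    have y2 : y ^ 2 ≤ 3.6914 ^ 2 := pow_le_pow_left₀ hy0 y1 2
    have : (1 - r + r ^ 2) * y ^ 2 ≤ 1.8176 * 3.6914 ^ 2 :=
      mul_le_mul x2 y2 (by positivity) (by norm_num)
    rw [← hnη] at this
    norm_num at this
  · exact (parity M ξ η hM h hpar).elim
  · have key : ∀ s : Cub ℤ, norm s ≠ 0 → η = s * s → _ := fun s h1 h2 =>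
      (⟨ξ, s, h1, Or.inl (by rw [← h2, h])⟩ : ∃ ξ s : Cub ℤ, norm s ≠ 0 ∧
      (M * (s * s) = ξ * ξ ∨ M * (s * s) = ⟨-1, -2, 0⟩ * (ξ * ξ)))
    rcases hs with h' | h' | h' | h'
    · exact key ⟨1, 0, 0⟩ (by decide) (by rw [h']; decide)
    · exact key ⟨0, 1, 0⟩ (by decide) (by rw [h']; decide)
    · exact key ⟨1, 1, 0⟩ (by decide) (by rw [h']; decide)
    · exact key ⟨3, 1, 1⟩ (by decide) (by rw [h']; decide)
  · have key : ∀ s : Cub ℤ, norm s ≠ 0 → η * ⟨-1, -2, 0⟩ = s * s → _ := fun s h1 h2 =>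
      (⟨ξ, s, h1, Or.inr (by rw [← h2, h]; ring)⟩ : ∃ ξ s : Cub ℤ, norm s ≠ 0 ∧
      (M * (s * s) = ξ * ξ ∨ M * (s * s) = ⟨-1, -2, 0⟩ * (ξ * ξ)))
    rcases hs with h' | h' | h' | h' | h' | h' | h'
    · exact key ⟨1, 2, 0⟩ (by decide) (by rw [h']; decide)
    · exact key ⟨1, 1, 0⟩ (by decide) (by rw [h']; decide)
    · exact key ⟨0, 1, 0⟩ (by decide) (by rw [h']; decide)
    · exact key ⟨0, 0, 1⟩ (by decide) (by rw [h']; decide)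
    · exact key ⟨1, 2, 1⟩ (by decide) (by rw [h']; decide)
    · exact key ⟨0, 1, 1⟩ (by decide) (by rw [h']; decide)
    · exact key ⟨1, 1, -1⟩ (by decide) (by rw [h']; decide)

end Cub

namespace Cub

theorem core2 (M β : Cub ℤ) (a b v : ℤ) (hv : v ≠ 0) (hβ : M * β = ⟨a, -b, 0⟩)
    (hN : norm M = v ^ 2) (hM : M.a % 2 = 1) (hc : IsCoprime b v) :
    ∃ ξ s : Cub ℤ, norm s ≠ 0 ∧
      (M * (s * s) = ξ * ξ ∨ M * (s * s) = ⟨-1, -2, 0⟩ * (ξ * ξ)) := by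
  obtain ⟨b', w, h⟩ := (hc.pow_right (n := 2))
  have hA : M * adj M = ⟨v ^ 2, 0, 0⟩ := by rw [mul_adj, hN]
  refine core M (adj M) (⟨-b', 0, 0⟩ * β + ⟨0, w, 0⟩ * adj M) v (a * b') hv hA ?_ hN hM
  have : M * (⟨-b', 0, 0⟩ * β + ⟨0, w, 0⟩ * adj M) =
    ⟨-b', 0, 0⟩ * (M * β) + ⟨0, w, 0⟩ * (M * adj M) := by ring
  rw [this, hA, hβ]
  ext <;> simp [mul_def, add_def]
  · ring
  · linear_combination h

/-- base change -/
def toQ : Cub ℤ →+* Cub ℚ where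
  toFun x := ⟨x.a, x.b, x.c⟩
  map_one' := by ext <;> simp [one_def]
  map_zero' := by ext <;> simp [zero_def]
  map_mul' x y := by ext <;> simp [mul_def]
  map_add' x y := by ext <;> simp [add_def]

theorem toQ_mk (a b c : ℤ) : toQ ⟨a, b, c⟩ = ⟨a, b, c⟩ := rfl
theorem norm_toQ (x : Cub ℤ) : norm (toQ x) = (norm x : ℤ) := by
  simp [norm, toQ]

theorem exists_inv (x : Cub ℚ) (h : norm x ≠ 0) : ∃ y, x * y = 1 := by
  refine ⟨adj x * ⟨(norm x)⁻¹, 0, 0⟩, ?_⟩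
  rw [← mul_assoc, mul_adj]
  ext <;> simp [mul_def, one_def, h]

/-- the class statement -/
def Cl (x : Cub ℚ) : Prop := ∃ s : Cub ℚ, x = s * s ∨ x = ⟨-1, -2, 0⟩ * (s * s)

theorem Cl_of (M ξ s : Cub ℤ) (hs : norm s ≠ 0)
    (h : M * (s * s) = ξ * ξ ∨ M * (s * s) = ⟨-1, -2, 0⟩ * (ξ * ξ)) : Cl (toQ M) := by
  obtain ⟨y, hy⟩ := exists_inv (toQ s) (by rw [norm_toQ]; exact_mod_cast hs)
  refine ⟨toQ ξ * y, ?_⟩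
  rcases h with h | h
  · left
    have := congrArg toQ h
    simp only [map_mul] at this
    calc toQ M = toQ M * (toQ s * y) * (toQ s * y) := by rw [hy]; ring
      _ = (toQ M * (toQ s * toQ s)) * (y * y) := by ring
      _ = _ := by rw [this]; ring
  · right
    have := congrArg toQ h
    simp only [map_mul, toQ_mk] at this
    push_cast at this
    calc toQ M = toQ M * (toQ s * y) * (toQ s * y) := by rw [hy]; ring
      _ = (toQ M * (toQ s * toQ s)) * (y * y) := by ring
      _ = _ := by rw [this]; ring

theorem Cl_mul_sq (x s : Cub ℚ) (h : Cl x) : Cl (x * (s * s)) := by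
  obtain ⟨y, h | h⟩ := h
  · exact ⟨y * s, Or.inl (by rw [h]; ring)⟩
  · exact ⟨y * s, Or.inr (by rw [h]; ring)⟩

theorem Cl_mul_eps (x : Cub ℚ) (h : Cl x) : Cl (x * ⟨-1, -2, 0⟩) := by
  obtain ⟨y, h | h⟩ := h
  · exact ⟨y, Or.inr (by rw [h]; ring)⟩
  · exact ⟨⟨-1, -2, 0⟩ * y, Or.inl (by rw [h]; ring)⟩

/-- integral form of the descent -/
theorem int_descent (a b z : ℤ) (hab : IsCoprime a b) (hpos : 0 < a - b) (hz : z ≠ 0)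
    (h : (a - b) * (a ^ 3 + a ^ 2 * b + 4 * a * b ^ 2 + 2 * b ^ 3) = z ^ 2) :
    (∃ u v : ℤ, v ≠ 0 ∧ u ≠ 0 ∧ a % 2 = 1 ∧ a - b = u ^ 2 ∧
      a ^ 3 + a ^ 2 * b + 4 * a * b ^ 2 + 2 * b ^ 3 = v ^ 2) ∨
    (∃ u v m : ℤ, v ≠ 0 ∧ u ≠ 0 ∧ b % 2 = 1 ∧ a - b = 2 * u ^ 2 ∧ a + b = 2 * m ∧
      a ^ 3 + a ^ 2 * b + 4 * a * b ^ 2 + 2 * b ^ 3 = 2 * v ^ 2) := by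
  have sqs : ∀ x y w : ℤ, 0 < x → IsCoprime x y → x * y = w ^ 2 → w ≠ 0 →
      ∃ u v : ℤ, u ≠ 0 ∧ v ≠ 0 ∧ x = u ^ 2 ∧ y = v ^ 2 := by
    intro x y w hx hc hw hw0
    have hy : 0 < y := by
      have : 0 < x * y := by rw [hw]; positivity
      exact (mul_pos_iff_of_pos_left hx).1 this
    obtain ⟨u, hu⟩ := Int.sq_of_isCoprime hc hw
    obtain ⟨v, hv⟩ := Int.sq_of_isCoprime hc.symm (by rw [mul_comm]; exact hw)
    have hu' : x = u ^ 2 := by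
      rcases hu with h | h
      · exact h
      · nlinarith [sq_nonneg u]
    have hv' : y = v ^ 2 := by
      rcases hv with h | h
      · exact h
      · nlinarith [sq_nonneg v]
    refine ⟨u, v, ?_, ?_, hu', hv'⟩
    · rintro rfl; simp at hu'; omega
    · rintro rfl; simp at hv'; omega
  have hbc : IsCoprime b (a - b) := by
    have := hab.symm.add_mul_left_right (-1)
    rwa [show a + b * -1 = a - b by ring] at this
  -- coprimality of an odd integer with 2
  have odd2 : ∀ x : ℤ, x % 2 = 1 → IsCoprime x 2 := fun x hx => ⟨1, -(x / 2), by omega⟩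
  have key : ∀ x k l: ℤ, IsCoprime b x → IsCoprime x k → IsCoprime x (k * b ^ 3 + x * l) := by
    intro x k l h1 h2
    exact ((h2.mul_right (h1.symm.pow_right)).add_mul_left_right l)
  rcases Int.emod_two_eq_zero_or_one (a - b) with hd | hd
  · -- both odd
    obtain ⟨c, hc⟩ : ∃ c, a = b + 2 * c := ⟨(a - b) / 2, by omega⟩
    subst hc
    have hbodd : b % 2 = 1 := by
      by_contra hb
      have h2 : (2 : ℤ) ∣ b := by omega
      have h3 : (2 : ℤ) ∣ b + 2 * c := by omega
      have := hab.isUnit_of_dvd' h3 h2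
      norm_num [Int.isUnit_iff] at this
    have hc0 : 0 < c := by omega
    have hbc' : IsCoprime b c := by
      rw [show b + 2 * c - b = c * 2 by ring] at hbc
      exact hbc.of_mul_right_left
    right
    have hmain : ∃ u v : ℤ, u ≠ 0 ∧ v ≠ 0 ∧ c = u ^ 2 ∧
        4 * b ^ 3 + 9 * b ^ 2 * c + 8 * b * c ^ 2 + 4 * c ^ 3 = v ^ 2 := by
      have hz2 : ∃ w, z = 2 * w := by
        have : (2 : ℤ) ^ 2 ∣ z ^ 2 := ⟨c * (4 * b ^ 3 + 9 * b ^ 2 * c + 8 * b * c ^ 2 + 4 * c ^ 3), by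
          rw [← h]; ring⟩
        rw [Int.pow_dvd_pow_iff (by norm_num)] at this
        exact this
      obtain ⟨w, rfl⟩ := hz2
      have h' : c * (4 * b ^ 3 + 9 * b ^ 2 * c + 8 * b * c ^ 2 + 4 * c ^ 3) = w ^ 2 := by
        nlinarith
      have hw0 : w ≠ 0 := by rintro rfl; simp at hz
      rcases Int.emod_two_eq_zero_or_one c with hce | hco
      · obtain ⟨e, rfl⟩ : ∃ e, c = 2 * e := ⟨c / 2, by omega⟩
        have hw2 : ∃ w', w = 2 * w' := by
          have : (2 : ℤ) ^ 2 ∣ w ^ 2 :=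
            ⟨e * (2 * b ^ 3 + 9 * b ^ 2 * e + 16 * b * e ^ 2 + 16 * e ^ 3), by rw [← h']; ring⟩
          rw [Int.pow_dvd_pow_iff (by norm_num)] at this
          exact this
        obtain ⟨w', rfl⟩ := hw2
        have h'' : e * (2 * b ^ 3 + 9 * b ^ 2 * e + 16 * b * e ^ 2 + 16 * e ^ 3) = w' ^ 2 := by
          nlinarith
        have hw0' : w' ≠ 0 := by rintro rfl; simp at hw0
        have hbe : IsCoprime b e := hbc'.of_mul_right_right
        rcases Int.emod_two_eq_zero_or_one e with hee | heo
        · obtain ⟨f, rfl⟩ : ∃ f, e = 2 * f := ⟨e / 2, by omega⟩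
          have hw3 : ∃ w'', w' = 2 * w'' := by
            have : (2 : ℤ) ^ 2 ∣ w' ^ 2 :=
              ⟨f * (b ^ 3 + 9 * b ^ 2 * f + 32 * b * f ^ 2 + 64 * f ^ 3), by rw [← h'']; ring⟩
            rw [Int.pow_dvd_pow_iff (by norm_num)] at this
            exact this
          obtain ⟨w'', rfl⟩ := hw3
          have h3 : f * (b ^ 3 + 9 * b ^ 2 * f + 32 * b * f ^ 2 + 64 * f ^ 3) = w'' ^ 2 := by
            nlinarith
          have hw0'' : w'' ≠ 0 := by rintro rfl; simp at hw0'
          have hbf : IsCoprime b f := hbe.of_mul_right_right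
          have hcop := key f 1 (9 * b ^ 2 + 32 * b * f + 64 * f ^ 2) hbf isCoprime_one_right
          obtain ⟨u, v, hu, hv, h5, h6⟩ := sqs f _ w'' (by omega) hcop (by rw [← h3]; ring) hw0''
          exact ⟨2 * u, 2 * v, by simpa using hu, by simpa using hv, by rw [h5]; ring, by
            linear_combination 4 * h6⟩
        · exfalso
          have hcop := key e 2 (9 * b ^ 2 + 16 * b * e + 16 * e ^ 2) hbe (odd2 e heo)
          obtain ⟨u, v, hu, hv, h5, h6⟩ := sqs e _ w' (by omega) hcop (by rw [← h'']; ring) hw0'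
          subst h5
          have hu2 : u % 2 = 1 := by
            rcases Int.emod_two_eq_zero_or_one u with h | h
            · exfalso
              obtain ⟨k, rfl⟩ : ∃ k, u = 2 * k := ⟨u / 2, by omega⟩
              ring_nf at heo
              omega
            · exact h
          have e1 : u ^ 2 % 8 = 1 := by
            obtain ⟨k, rfl⟩ : ∃ k, u = 2 * k + 1 := ⟨u / 2, by omega⟩
            have : (2 * k + 1) ^ 2 = 4 * (k * (k + 1)) + 1 := by ring
            rw [this]
            have : k * (k + 1) % 2 = 0 := Int.emod_eq_zero_of_dvd (Int.even_mul_succ_self k).two_dvd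
            omega
          have e2 : b ^ 2 % 8 = 1 := by
            obtain ⟨k, rfl⟩ : ∃ k, b = 2 * k + 1 := ⟨b / 2, by omega⟩
            have : (2 * k + 1) ^ 2 = 4 * (k * (k + 1)) + 1 := by ring
            rw [this]
            have : k * (k + 1) % 2 = 0 := Int.emod_eq_zero_of_dvd (Int.even_mul_succ_self k).two_dvd
            omega
          obtain ⟨p, hp⟩ : ∃ p, u ^ 2 = 8 * p + 1 := ⟨u ^ 2 / 8, by omega⟩
          obtain ⟨q, hq⟩ : ∃ q, b ^ 2 = 8 * q + 1 := ⟨b ^ 2 / 8, by omega⟩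
          have hb3 : b ^ 3 = b * (8 * q + 1) := by rw [← hq]; ring
          rw [hp, hb3, hq] at h6
          obtain ⟨k, rfl⟩ : ∃ k, b = 2 * k + 1 := ⟨b / 2, by omega⟩
          rcases Int.emod_two_eq_zero_or_one v with hvv | hvv
          · obtain ⟨l, rfl⟩ : ∃ k, v = 2 * k := ⟨v / 2, by omega⟩
            ring_nf at h6; omega
          · obtain ⟨l, rfl⟩ : ∃ k, v = 2 * k + 1 := ⟨v / 2, by omega⟩
            ring_nf at h6; omega
      · have hc4 : IsCoprime c 4 := by
          have := (odd2 c hco).pow_right (n := 2)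
          norm_num at this; exact this
        have hcop := key c 4 (9 * b ^ 2 + 8 * b * c + 4 * c ^ 2) hbc' hc4
        obtain ⟨u, v, hu, hv, h5, h6⟩ := sqs c _ w hc0 hcop (by rw [← h']; ring) hw0
        exact ⟨u, v, hu, hv, h5, by rw [← h6]; ring⟩
    obtain ⟨u, v, hu, hv, h5, h6⟩ := hmain
    exact ⟨u, v, b + c, hv, hu, hbodd, by rw [← h5]; ring, by ring, by rw [← h6]; ring⟩
  · left
    have h8 : IsCoprime (a - b) 8 := by
      have := (odd2 (a - b) hd).pow_right (n := 3)
      norm_num at this; exact this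
    have hcop := key (a - b) 8 (a ^ 2 + 2 * a * b + 6 * b ^ 2) hbc h8
    obtain ⟨u, v, hu, hv, h5, h6⟩ := sqs (a - b) _ z hpos hcop (by rw [← h]; ring) hz
    have h6' : a ^ 3 + a ^ 2 * b + 4 * a * b ^ 2 + 2 * b ^ 3 = v ^ 2 := by rw [← h6]; ring
    refine ⟨u, v, hv, hu, ?_, h5, h6'⟩
    by_contra ha
    obtain ⟨k, rfl⟩ : ∃ k, a = 2 * k := ⟨a / 2, by omega⟩
    obtain ⟨l, rfl⟩ : ∃ k, b = 2 * k + 1 := ⟨b / 2, by omega⟩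
    rcases Int.emod_two_eq_zero_or_one v with hvv | hvv
    · obtain ⟨l, rfl⟩ : ∃ k, v = 2 * k := ⟨v / 2, by omega⟩
      ring_nf at h6'; omega
    · obtain ⟨l, rfl⟩ : ∃ k, v = 2 * k + 1 := ⟨v / 2, by omega⟩
      ring_nf at h6'; omega

theorem no_root (X : ℚ) : X ^ 3 + 5 * X + 22 ≠ 0 := by
  intro h
  have hd : (X.den : ℚ) ≠ 0 := by exact_mod_cast X.den_nz
  have hX : X * X.den = X.num := Rat.mul_den_eq_num X
  have h1 : (X.num : ℚ) ^ 3 + 5 * X.num * X.den ^ 2 + 22 * X.den ^ 3 = 0 := by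
    rw [← hX]; linear_combination (X.den : ℚ) ^ 3 * h
  have h2 : X.num ^ 3 + 5 * X.num * (X.den : ℤ) ^ 2 + 22 * (X.den : ℤ) ^ 3 = 0 := by
    exact_mod_cast h1
  have hc : IsCoprime X.num (X.den : ℤ) := by
    rw [Int.isCoprime_iff_gcd_eq_one]; exact X.reduced
  have hdv : (X.den : ℤ) ∣ X.num ^ 3 := ⟨-(5 * X.num * X.den + 22 * X.den ^ 2), by linear_combination h2⟩
  have hu : IsUnit (X.den : ℤ) := (hc.pow_left (m := 3)).isUnit_of_dvd' hdv dvd_rfl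
  have hd1 : (X.den : ℤ) = 1 := by
    rcases Int.isUnit_iff.1 hu with h | h
    · exact h
    · have := X.den_pos; omega
  rw [hd1] at h2
  have a1 : X.num < -2 + 1 := by nlinarith [sq_nonneg X.num, sq_nonneg (X.num + 1)]
  have a2 : -3 < X.num := by
    by_contra hh
    nlinarith [sq_nonneg X.num, sq_nonneg (X.num - 3)]
  have : X.num = -2 := by omega
  rw [this] at h2
  norm_num at h2

theorem cl_point (X Y : ℚ) (h : Y ^ 2 = X ^ 3 + 5 * X + 22) : Cl ⟨X + 3, 2, 1⟩ := by
  by_cases hX : X = 3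
  · subst hX
    exact ⟨⟨2, 0, 1⟩, Or.inl (by ext <;> norm_num [mul_def])⟩
  have hX3 : X - 3 ≠ 0 := sub_ne_zero.2 hX
  have hY : Y ≠ 0 := by
    rintro rfl
    exact no_root X (by rw [← h]; norm_num)
  -- choose a, b
  obtain ⟨a, b, hab, hpos, hq⟩ : ∃ a b : ℤ, IsCoprime a b ∧ 0 < a - b ∧
      (a : ℚ) * (X - 3) = b * (X + 5) := by
    set q : ℚ := (X + 5) / (X - 3) with hq
    have hc : IsCoprime q.num (q.den : ℤ) := by
      rw [Int.isCoprime_iff_gcd_eq_one]; exact q.reduced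
    have hd : (q.den : ℚ) ≠ 0 := by exact_mod_cast q.den_nz
    have hqn : q * q.den = q.num := Rat.mul_den_eq_num q
    have hrel : (q.num : ℚ) * (X - 3) = (q.den : ℤ) * (X + 5) := by
      rw [← hqn, hq]; push_cast; field_simp
    have hne : q.num - (q.den : ℤ) ≠ 0 := by
      intro h0
      have : (q.num : ℚ) = (q.den : ℤ) := by exact_mod_cast (sub_eq_zero.1 h0)
      rw [this] at hrel
      have := mul_left_cancel₀ (by exact_mod_cast q.den_nz) hrel
      linarith
    rcases lt_or_gt_of_ne hne with h0 | h0
    · exact ⟨-q.num, -q.den, hc.neg_neg, by omega, by push_cast; push_cast at hrel; linarith⟩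
    · exact ⟨q.num, q.den, hc, h0, hrel⟩
  have hD : ((a : ℚ) - b) ≠ 0 := by
    have : ((a - b : ℤ) : ℚ) ≠ 0 := by exact_mod_cast hpos.ne'
    push_cast at this; exact this
  have hD8 : ((a : ℚ) - b) * (X - 3) = 8 * b := by linear_combination hq
  have hXab : X = 3 + 8 * b / (a - b) := by
    field_simp; linear_combination hD8
  -- integral square
  obtain ⟨z, hz⟩ : ∃ z : ℤ, (a - b) * (a ^ 3 + a ^ 2 * b + 4 * a * b ^ 2 + 2 * b ^ 3) = z ^ 2 := by
    have : IsSquare (((a - b) * (a ^ 3 + a ^ 2 * b + 4 * a * b ^ 2 + 2 * b ^ 3) : ℤ) : ℚ) := by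
      refine ⟨(a - b) ^ 2 * Y / 8, ?_⟩
      have e : ((a : ℚ) - b) ^ 2 * Y / 8 * ((a - b) ^ 2 * Y / 8) = (a - b) ^ 4 * Y ^ 2 / 64 := by ring
      rw [e, h, hXab]; push_cast
      field_simp
      ring
    obtain ⟨z, hz⟩ := Rat.isSquare_intCast_iff.1 this
    exact ⟨z, by rw [hz]; ring⟩
  have hz0 : z ≠ 0 := by
    rintro rfl
    have h2 : a ^ 3 + a ^ 2 * b + 4 * a * b ^ 2 + 2 * b ^ 3 = 0 := by
      have := hz
      simp only [ne_eq, OfNat.ofNat_ne_zero, not_false_eq_true, zero_pow, mul_eq_zero] at this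
      rcases this with h | h
      · omega
      · exact h
    have h3 : (a : ℚ) ^ 3 + a ^ 2 * b + 4 * a * b ^ 2 + 2 * b ^ 3 = 0 := by exact_mod_cast h2
    apply no_root X
    rw [hXab]
    field_simp
    linear_combination 64 * h3
  have hform : ∀ k : ℚ, k ≠ 0 → (⟨X + 3, 2, 1⟩ : Cub ℚ) = ⟨a, -b, 0⟩ * (⟨2, 0, 1⟩ * ⟨2, 0, 1⟩)
      * ⟨((a : ℚ) - b)⁻¹, 0, 0⟩ := by
    intro k hk
    rw [hXab]
    ext <;> simp [mul_def] <;> field_simp <;> ring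
  have hform := hform 1 one_ne_zero
  rcases int_descent a b z hab hpos hz0 hz with ⟨u, v, hv, hu, ha, h1, h2⟩ | ⟨u, v, m, hv, hu, hb, h1, hm, h2⟩
  · have hcop : IsCoprime b v := by
      have : IsCoprime b (a ^ 3 + b * (a ^ 2 + 4 * a * b + 2 * b ^ 2)) :=
        (hab.symm.pow_right (n := 3)).add_mul_left_right _
      rw [show a ^ 3 + b * (a ^ 2 + 4 * a * b + 2 * b ^ 2) = v * v by rw [← pow_two, ← h2]; ring] at this
      exact this.of_mul_right_left
    obtain ⟨ξ, s, hs, hh⟩ := core2 ⟨a, -b, 0⟩ 1 a b v hv (mul_one _) (by rw [← h2]; simp [norm]; ring)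
      ha hcop
    have hcl := Cl_of _ ξ s hs hh
    rw [toQ_mk] at hcl
    push_cast at hcl
    have huQ : (u : ℚ) ≠ 0 := by exact_mod_cast hu
    have h1' : (a : ℚ) - b = u ^ 2 := by exact_mod_cast h1
    have := Cl_mul_sq _ (⟨2, 0, 1⟩ * ⟨(u : ℚ)⁻¹, 0, 0⟩) hcl
    convert this using 1
    rw [hform, h1']
    have : (⟨((u : ℚ) ^ 2)⁻¹, 0, 0⟩ : Cub ℚ) = ⟨(u : ℚ)⁻¹, 0, 0⟩ * ⟨(u : ℚ)⁻¹, 0, 0⟩ := by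
      ext <;> simp [mul_def]; ring
    rw [this]; ring
  · have hcop : IsCoprime b v := by
      have : IsCoprime b (a ^ 3 + b * (a ^ 2 + 4 * a * b + 2 * b ^ 2)) :=
        (hab.symm.pow_right (n := 3)).add_mul_left_right _
      rw [show a ^ 3 + b * (a ^ 2 + 4 * a * b + 2 * b ^ 2) = v * (2 * v) by linear_combination h2] at this
      exact this.of_mul_right_left
    obtain rfl : a = 2 * m - b := by omega
    obtain ⟨ξ, s, hs, hh⟩ := core2 ⟨4 * m - b, 0, m⟩ ⟨1, 1, 0⟩ (2 * m - b) b v hv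
      (by ext <;> simp [mul_def] <;> ring) (by
        have : 2 * norm (⟨4 * m - b, 0, m⟩ : Cub ℤ) = 2 * v ^ 2 := by
          rw [← h2]; simp [norm]; ring
        omega)
      (by simp only; omega) hcop
    have hcl := Cl_of _ ξ s hs hh
    rw [toQ_mk] at hcl
    push_cast at hcl
    have huQ : (u : ℚ) ≠ 0 := by exact_mod_cast hu
    have h1' : ((2 * m - b : ℤ) : ℚ) - b = 2 * u ^ 2 := by exact_mod_cast h1
    have := Cl_mul_sq _ (⟨2, 0, 1⟩ * ⟨-2 * (u : ℚ)⁻¹, -1 / 2 * (u : ℚ)⁻¹, -1 / 2 * (u : ℚ)⁻¹⟩) (Cl_mul_eps _ hcl)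
    convert this using 1
    rw [hform, h1']
    push_cast
    ext <;> simp [mul_def] <;> field_simp <;> ring

end Cub

namespace Cub

def WE : WeierstrassCurve.Affine ℚ := ⟨0, 0, 0, 5, 22⟩

abbrev Pt := WE.Point

def OnE (x y : ℚ) : Prop := y ^ 2 = x ^ 3 + 5 * x + 22

theorem OnE.ns {x y : ℚ} (h : OnE x y) : WE.Nonsingular x y := by
  unfold OnE at h
  rw [WeierstrassCurve.Affine.nonsingular_iff, WeierstrassCurve.Affine.equation_iff]
  refine ⟨by simp [WE]; linarith, Or.inr ?_⟩
  simp only [WE]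
  intro h2
  have : y = 0 := by linarith
  subst this
  exact no_root x (by linarith)

theorem OnE.y_ne {x y : ℚ} (h : OnE x y) : y ≠ 0 := by
  rintro rfl
  exact no_root x (by unfold OnE at h; linarith)

def pt (x y : ℚ) (h : OnE x y) : Pt := .some x y h.ns

theorem pt_cases (P : Pt) : P = 0 ∨ ∃ x y h, P = pt x y h := by
  rcases P with _ | ⟨x, y, h⟩
  · left; rfl
  · right
    have h1 := h.1
    rw [WeierstrassCurve.Affine.equation_iff] at h1
    simp [WE] at h1
    exact ⟨x, y, by unfold OnE; linarith, rfl⟩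

theorem pt_ext {x y x' y' : ℚ} (h : OnE x y) (h' : OnE x' y') (hx : x = x') (hy : y = y') :
    pt x y h = pt x' y' h' := by
  subst hx; subst hy; rfl

theorem pt_inj {x y x' y' : ℚ} {h : OnE x y} {h' : OnE x' y'} (e : pt x y h = pt x' y' h') :
    x = x' ∧ y = y' := by
  unfold pt at e
  simpa using e

theorem pt_ne_zero {x y : ℚ} (h : OnE x y) : pt x y h ≠ 0 :=
  WeierstrassCurve.Affine.Point.some_ne_zero _

theorem OnE.neg {x y : ℚ} (h : OnE x y) : OnE x (-y) := by unfold OnE at *; linarith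

theorem neg_pt {x y : ℚ} (h : OnE x y) : -pt x y h = pt x (-y) h.neg := by
  unfold pt
  rw [WeierstrassCurve.Affine.Point.neg_some, WeierstrassCurve.Affine.Point.some.injEq]
  simp [WeierstrassCurve.Affine.negY, WE]

theorem OnE.eq_or {x y z : ℚ} (h : OnE x y) (h' : OnE x z) : y = z ∨ y = -z := by
  unfold OnE at *
  exact sq_eq_sq_iff_eq_or_eq_neg.mp (by linarith)

theorem add_pt {x₁ y₁ x₂ y₂ : ℚ} (h₁ : OnE x₁ y₁) (h₂ : OnE x₂ y₂) (hx : x₁ ≠ x₂) {l x₃ y₃ : ℚ}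
    (hl : l * (x₁ - x₂) = y₁ - y₂) (hx₃ : x₃ = l ^ 2 - x₁ - x₂) (hy₃ : y₃ = -(y₁ + l * (x₃ - x₁))) :
    ∃ h, pt x₁ y₁ h₁ + pt x₂ y₂ h₂ = pt x₃ y₃ h := by
  have hs : WE.slope x₁ x₂ y₁ y₂ = l := by
    rw [WeierstrassCurve.Affine.slope_of_X_ne hx, div_eq_iff (sub_ne_zero.mpr hx), hl]
  have h3 : OnE x₃ y₃ := by
    have := (WeierstrassCurve.Affine.nonsingular_add h₁.ns h₂.ns (fun h => hx h.1)).1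
    rw [hs, WeierstrassCurve.Affine.equation_iff] at this
    simp [WE, WeierstrassCurve.Affine.addX, WeierstrassCurve.Affine.addY,
      WeierstrassCurve.Affine.negAddY, WeierstrassCurve.Affine.negY] at this
    unfold OnE
    rw [hy₃, hx₃]
    linear_combination this
  refine ⟨h3, ?_⟩
  unfold pt
  rw [WeierstrassCurve.Affine.Point.add_of_X_ne hx, WeierstrassCurve.Affine.Point.some.injEq, hs]
  simp [WE, WeierstrassCurve.Affine.addX, WeierstrassCurve.Affine.addY,
      WeierstrassCurve.Affine.negAddY, WeierstrassCurve.Affine.negY]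
  refine ⟨hx₃.symm, ?_⟩
  rw [hy₃, hx₃]; ring

theorem dbl_pt {x₁ y₁ : ℚ} (h₁ : OnE x₁ y₁) {l x₃ y₃ : ℚ}
    (hl : l * (2 * y₁) = 3 * x₁ ^ 2 + 5) (hx₃ : x₃ = l ^ 2 - 2 * x₁) (hy₃ : y₃ = -(y₁ + l * (x₃ - x₁))) :
    ∃ h, pt x₁ y₁ h₁ + pt x₁ y₁ h₁ = pt x₃ y₃ h := by
  have hy : y₁ ≠ WE.negY x₁ y₁ := by
    simp [WE, WeierstrassCurve.Affine.negY]
    intro h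
    exact h₁.y_ne (by linarith)
  have hs : WE.slope x₁ x₁ y₁ y₁ = l := by
    rw [WeierstrassCurve.Affine.slope_of_Y_ne rfl hy, div_eq_iff (sub_ne_zero.mpr hy)]
    simp [WE, WeierstrassCurve.Affine.negY]
    linarith
  have h3 : OnE x₃ y₃ := by
    have := (WeierstrassCurve.Affine.nonsingular_add h₁.ns h₁.ns (fun h => hy h.2)).1
    rw [hs, WeierstrassCurve.Affine.equation_iff] at this
    simp [WE, WeierstrassCurve.Affine.addX, WeierstrassCurve.Affine.addY,
      WeierstrassCurve.Affine.negAddY, WeierstrassCurve.Affine.negY] at this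
    unfold OnE
    rw [hy₃, hx₃]
    linear_combination this
  refine ⟨h3, ?_⟩
  unfold pt
  rw [WeierstrassCurve.Affine.Point.add_self_of_Y_ne hy, WeierstrassCurve.Affine.Point.some.injEq, hs]
  simp [WE, WeierstrassCurve.Affine.addX, WeierstrassCurve.Affine.addY,
      WeierstrassCurve.Affine.negAddY, WeierstrassCurve.Affine.negY]
  refine ⟨by rw [hx₃]; ring, ?_⟩
  rw [hy₃, hx₃]; ring

theorem onE_G : OnE (-1) 4 := by unfold OnE; norm_num

def G : Pt := pt (-1) 4 onE_G

end Cub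

namespace Cub

theorem sq_half (X Y : ℚ) (h : OnE X Y) (s : Cub ℚ) (hs : (⟨X + 3, 2, 1⟩ : Cub ℚ) = s * s) :
    ∃ Q : Pt, pt X Y h = Q + Q := by
  obtain ⟨a, b, c⟩ := s
  obtain ⟨c2, hc2⟩ : ∃ c2 : ℚ, c2 = (2 * c - b) / 8 := ⟨_, rfl⟩
  obtain ⟨c1, hc1⟩ : ∃ c1 : ℚ, c1 = 3 * c2 - c := ⟨_, rfl⟩
  obtain ⟨c0, hc0⟩ : ∃ c0 : ℚ, c0 = a + 3 * c1 - 3 * c2 := ⟨_, rfl⟩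
  obtain rfl : c = 3 * c2 - c1 := by linarith
  obtain rfl : b = -2 * c1 - 2 * c2 := by linarith
  obtain rfl : a = c0 - 3 * c1 + 3 * c2 := by linarith
  clear hc0 hc1 hc2
  rw [mul_def, Cub.ext_iff] at hs
  obtain ⟨e1, e2, e3⟩ := hs
  simp only at e1 e2 e3
  have f2 : c1 ^ 2 + 2 * c0 * c2 - 5 * c2 ^ 2 = 0 := by
    linarith
  have f1 : 2 * c0 * c1 - 10 * c1 * c2 - 22 * c2 ^ 2 = -1 := by
    linarith
  have f0 : X = c0 ^ 2 - 44 * c1 * c2 := by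
    linarith
  have hc : c2 ≠ 0 := by
    rintro rfl
    have : c1 = 0 := by nlinarith
    subst this
    norm_num at f1
  obtain ⟨w, hw⟩ : ∃ w, w = c1 / c2 := ⟨_, rfl⟩
  obtain ⟨r, hr⟩ : ∃ r, r = 1 / c2 := ⟨_, rfl⟩
  have hrc : r * c2 = 1 := by rw [hr]; field_simp
  obtain rfl : c1 = w * c2 := by rw [hw]; field_simp
  have g0 : c0 = (5 - w ^ 2) * c2 / 2 := by
    have : c2 * (c0 - (5 - w ^ 2) * c2 / 2) = 0 := by linear_combination f2 / 2
    rcases mul_eq_zero.mp this with h | h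
    · exact absurd h hc
    · linarith
  subst g0
  have hk : c2 ^ 2 * (w ^ 3 + 5 * w + 22) = 1 := by linear_combination -f1
  have hE : OnE w r := by
    unfold OnE
    linear_combination (-r^2) * hk + (w^3+5*w+22) * (r * c2 + 1) * hrc
  obtain ⟨h3, h4⟩ := dbl_pt hE (l := (3 * w ^ 2 + 5) * c2 / 2) (x₃ := X) (y₃ := _) (by linear_combination (3 * w ^ 2 + 5) * hrc)
    (by rw [f0]; linear_combination (-2*w)*hk) rfl
  rcases h.eq_or h3 with h5 | h5
  · exact ⟨pt w r hE, by rw [h4]; exact pt_ext _ _ rfl h5⟩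
  · refine ⟨-pt w r hE, ?_⟩
    rw [← neg_add, h4, neg_pt]
    exact pt_ext _ _ rfl h5

theorem inv_sq {x z : Cub ℚ} (y : Cub ℚ) (hn : norm x ≠ 0) (h : z * x = y * y)
    (hx : ∃ s, x = s * s) : ∃ s, z = s * s := by
  obtain ⟨s, rfl⟩ := hx
  rw [norm_mul] at hn
  obtain ⟨t, ht⟩ := exists_inv s (left_ne_zero_of_mul hn)
  refine ⟨y * t, ?_⟩
  calc z = z * (s * t) * (s * t) := by rw [ht]; ring
    _ = (z * (s * s)) * t * t := by ring
    _ = _ := by rw [h]; ring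

theorem half (P : Pt) : ∃ Q, P = Q + Q ∨ P + G = Q + Q := by
  rcases pt_cases P with rfl | ⟨X, Y, h, rfl⟩
  · exact ⟨0, by simp⟩
  obtain ⟨s, hs | hs⟩ := cl_point X Y h
  · obtain ⟨Q, hQ⟩ := sq_half X Y h s hs
    exact ⟨Q, Or.inl hQ⟩
  by_cases hX : X = -1
  · subst hX
    rcases h.eq_or onE_G with h1 | h1
    · exact ⟨G, Or.inr (by unfold G; rw [pt_ext h onE_G rfl h1])⟩
    · refine ⟨0, Or.inr ?_⟩
      have : pt (-1) Y h = - G := by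
        unfold G; rw [neg_pt]; exact pt_ext _ _ rfl h1
      rw [this]; simp
  · have hX' : X + 1 ≠ 0 := fun h => hX (by linarith)
    obtain ⟨l, hl⟩ : ∃ l, l = (Y - 4) / (X + 1) := ⟨_, rfl⟩
    have hl' : l * (X - -1) = Y - 4 := by rw [hl]; field_simp; ring
    obtain ⟨h3, h4⟩ := add_pt h onE_G hX hl' rfl rfl
    have h4' : pt X Y h + G = _ := h4
    have hn : norm (⟨X + 3, 2, 1⟩ * ⟨2, 2, 1⟩ : Cub ℚ) ≠ 0 := by
      rw [norm_mul]
      have h1 : norm (⟨X + 3, 2, 1⟩ : Cub ℚ) = Y ^ 2 := by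
        rw [h]; simp [norm]; ring
      have h2 : norm (⟨2, 2, 1⟩ : Cub ℚ) = 16 := by simp [norm]; norm_num
      rw [h1, h2]
      have := h.y_ne
      positivity
    have hsq : ∃ t, (⟨X + 3, 2, 1⟩ * ⟨2, 2, 1⟩ : Cub ℚ) = t * t := by
      refine ⟨⟨-1, -2, 0⟩ * s * ⟨4, 0, 1⟩, ?_⟩
      have : (⟨2, 2, 1⟩ : Cub ℚ) = ⟨-1, -2, 0⟩ * (⟨4, 0, 1⟩ * ⟨4, 0, 1⟩) := by
        ext <;> simp [mul_def] <;> norm_num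
      rw [hs, this]; ring
    obtain ⟨l, rfl⟩ : ∃ l', l' = l := ⟨_, rfl⟩
    obtain ⟨t, ht⟩ := inv_sq (z := ⟨l ^ 2 - X - (-1) + 3, 2, 1⟩)
      (⟨4 + l + l * (-3), l * (-2), l * (-1)⟩) hn (by
        have hY : Y = l * (X + 1) + 4 := by linarith
        have hq : X ^ 2 - X + 6 = l ^ 2 * (X + 1) + 8 * l := by
          have h := h
          unfold OnE at h
          rw [hY] at h
          have : (X + 1) * (X ^ 2 - X + 6 - (l ^ 2 * (X + 1) + 8 * l)) = 0 := by linear_combination -h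
          rcases mul_eq_zero.mp this with h | h
          · exact absurd h hX'
          · linarith
        ext <;> simp [mul_def] <;> linarith) hsq
    obtain ⟨Q, hQ⟩ := sq_half _ _ h3 t ht
    exact ⟨Q, Or.inr (h4'.trans hQ)⟩

end Cub

namespace Cub

def Rep (P : Pt) (p q : ℤ) : Prop :=
  IsCoprime p q ∧ ((P = 0 ∧ q = 0) ∨ ∃ X Y h, P = pt X Y h ∧ q ≠ 0 ∧ (X + 1) * q = 4 * p)

theorem Rep.neg {P : Pt} {p q : ℤ} (h : Rep P p q) : Rep (-P) p q := by
  refine ⟨h.1, ?_⟩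
  rcases h.2 with ⟨rfl, hq⟩ | ⟨X, Y, hE, rfl, hq, he⟩
  · left; simp [hq]
  · right; exact ⟨X, -Y, hE.neg, neg_pt hE, hq, he⟩

theorem rep_zero : Rep 0 1 0 := ⟨isCoprime_one_left, Or.inl ⟨rfl, rfl⟩⟩

theorem rep_pt {X Y : ℚ} (h : OnE X Y) {p q : ℤ} (hr : Rep (pt X Y h) p q) :
    q ≠ 0 ∧ (X + 1) * q = 4 * p := by
  rcases hr.2 with ⟨h0, _⟩ | ⟨X', Y', h', he, hq, h2⟩
  · exact absurd h0 (pt_ne_zero h)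
  · obtain ⟨rfl, rfl⟩ := pt_inj he
    exact ⟨hq, h2⟩

theorem rep_zero' {p q : ℤ} (hr : Rep 0 p q) : q = 0 ∧ p ^ 2 = 1 := by
  rcases hr.2 with ⟨_, h0⟩ | ⟨X', Y', h', he, hq, h2⟩
  · refine ⟨h0, ?_⟩
    have := hr.1
    rw [h0, isCoprime_zero_right, Int.isUnit_iff] at this
    rcases this with h | h <;> simp [h]
  · exact absurd he.symm (pt_ne_zero h')

theorem rep_cross {P : Pt} {p q p' q' : ℤ} (h : Rep P p q) (h' : Rep P p' q') : p * q' = p' * q := by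
  rcases pt_cases P with rfl | ⟨X, Y, hE, rfl⟩
  · rw [(rep_zero' h).1, (rep_zero' h').1]; ring
  · have h1 := (rep_pt hE h).2
    have h2 := (rep_pt hE h').2
    have : (p * q' : ℚ) = p' * q := by linear_combination (q / 4 : ℚ) * h2 - (q' / 4 : ℚ) * h1
    exact_mod_cast this

theorem exists_rep (P : Pt) : ∃ p q, Rep P p q := by
  rcases pt_cases P with rfl | ⟨X, Y, hE, rfl⟩
  · exact ⟨1, 0, rep_zero⟩
  · refine ⟨((X + 1) / 4).num, ((X + 1) / 4).den, ?_, Or.inr ⟨X, Y, hE, rfl, ?_, ?_⟩⟩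
    · exact Int.isCoprime_iff_gcd_eq_one.mpr ((X + 1) / 4).reduced
    · exact_mod_cast ((X + 1) / 4).den_nz
    · have := Rat.mul_den_eq_num ((X + 1) / 4)
      push_cast
      linarith

theorem prim {p₃ q₃ p₄ q₄ a b c : ℤ} (h3 : IsCoprime p₃ q₃) (h4 : IsCoprime p₄ q₄)
    (e1 : a * (p₃ * q₄ + p₄ * q₃) = b * (p₃ * p₄)) (e2 : a * (q₃ * q₄) = c * (p₃ * p₄))
    (e3 : b * (q₃ * q₄) = c * (p₃ * q₄ + p₄ * q₃)) :
    ∃ k, a = k * (p₃ * p₄) ∧ b = k * (p₃ * q₄ + p₄ * q₃) ∧ c = k * (q₃ * q₄) := by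
  have hb : ∃ α β γ, α * (p₃ * p₄) + β * (p₃ * q₄ + p₄ * q₃) + γ * (q₃ * q₄) = 1 := by
    obtain ⟨x, y, hxy⟩ := h3.pow (m := 2) (n := 2)
    obtain ⟨z, w, hzw⟩ := h4.pow (m := 2) (n := 2)
    refine ⟨x * z * (p₃ * p₄) - (x * w + y * z) * (q₃ * q₄), x * w * (p₃ * q₄) + y * z * (q₃ * p₄), y * w * (q₃ * q₄), ?_⟩
    linear_combination (z * p₄ ^ 2 + w * q₄ ^ 2) * hxy + hzw
  obtain ⟨α, β, γ, h⟩ := hb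
  refine ⟨α * a + β * b + γ * c, ?_, ?_, ?_⟩
  · linear_combination (-a) * h + β * e1 + γ * e2
  · linear_combination (-b) * h - α * e1 + γ * e3
  · linear_combination (-c) * h - α * e2 - β * e3

def Par (p₁ q₁ p₂ q₂ p₃ q₃ p₄ q₄ : ℤ) : Prop :=
  ∃ k : ℤ, k ≠ 0 ∧
    (p₁*p₂)^2 - (p₁*p₂)*(q₁*q₂) - (p₁*q₂+p₂*q₁)*(q₁*q₂) + (q₁*q₂)^2 = k * (p₃ * p₄) ∧
    2*(p₁*q₂+p₂*q₁)*(p₁*p₂) - 3*(p₁*p₂)*(q₁*q₂) + (p₁*q₂+p₂*q₁)*(q₁*q₂) + (q₁*q₂)^2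
      = k * (p₃ * q₄ + p₄ * q₃) ∧
    (p₁*q₂-p₂*q₁)^2 = k * (q₃ * q₄)

theorem Par.swap {p₁ q₁ p₂ q₂ p₃ q₃ p₄ q₄ : ℤ} (h : Par p₁ q₁ p₂ q₂ p₃ q₃ p₄ q₄) :
    Par p₁ q₁ p₂ q₂ p₄ q₄ p₃ q₃ := by
  obtain ⟨k, h0, h1, h2, h3⟩ := h
  exact ⟨k, h0, by rw [h1]; ring, by rw [h2]; ring, by rw [h3]; ring⟩

theorem Par.symm {p₁ q₁ p₂ q₂ p₃ q₃ p₄ q₄ : ℤ} (h : Par p₁ q₁ p₂ q₂ p₃ q₃ p₄ q₄) :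
    Par p₂ q₂ p₁ q₁ p₃ q₃ p₄ q₄ := by
  obtain ⟨k, h0, h1, h2, h3⟩ := h
  exact ⟨k, h0, by rw [← h1]; ring, by rw [← h2]; ring, by rw [← h3]; ring⟩

theorem par_of {p₁ q₁ p₂ q₂ p₃ q₃ p₄ q₄ : ℤ} {a b c : ℤ} (h3 : IsCoprime p₃ q₃) (h4 : IsCoprime p₄ q₄)
    (ha : a = (p₁*p₂)^2 - (p₁*p₂)*(q₁*q₂) - (p₁*q₂+p₂*q₁)*(q₁*q₂) + (q₁*q₂)^2)
    (hb : b = 2*(p₁*q₂+p₂*q₁)*(p₁*p₂) - 3*(p₁*p₂)*(q₁*q₂) + (p₁*q₂+p₂*q₁)*(q₁*q₂) + (q₁*q₂)^2)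
    (hc : c = (p₁*q₂-p₂*q₁)^2)
    (e1 : a * (p₃ * q₄ + p₄ * q₃) = b * (p₃ * p₄)) (e2 : a * (q₃ * q₄) = c * (p₃ * p₄))
    (e3 : b * (q₃ * q₄) = c * (p₃ * q₄ + p₄ * q₃)) (hne : a ≠ 0 ∨ b ≠ 0 ∨ c ≠ 0) :
    Par p₁ q₁ p₂ q₂ p₃ q₃ p₄ q₄ := by
  obtain ⟨k, h1, h2, h5⟩ := prim h3 h4 e1 e2 e3
  refine ⟨k, ?_, ha ▸ h1, hb ▸ h2, hc ▸ h5⟩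
  rintro rfl
  simp at h1 h2 h5
  tauto

theorem par_zero {Q : Pt} {p₁ q₁ p₂ q₂ p₃ q₃ p₄ q₄ : ℤ} (h1 : Rep 0 p₁ q₁) (h2 : Rep Q p₂ q₂)
    (h3 : Rep Q p₃ q₃) (h4 : Rep Q p₄ q₄) : Par p₁ q₁ p₂ q₂ p₃ q₃ p₄ q₄ := by
  obtain ⟨rfl, hp⟩ := rep_zero' h1
  have e3 := rep_cross h2 h3
  have e4 := rep_cross h2 h4
  refine par_of h3.1 h4.1 (a := p₂ ^ 2) (b := 2 * p₂ * q₂) (c := q₂ ^ 2) ?_ ?_ ?_ ?_ ?_ ?_ ?_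
  · linear_combination (-p₂ ^ 2) * hp
  · linear_combination (-2 * p₂ * q₂) * hp
  · linear_combination (-q₂ ^ 2) * hp
  · linear_combination p₂ * p₃ * e4 + p₂ * p₄ * e3
  · linear_combination p₂ * q₃ * e4 + p₄ * q₂ * e3
  · linear_combination q₂ * q₃ * e4 + q₂ * q₄ * e3
  · by_contra! h
    have hp2 : p₂ = 0 := by simpa using h.1
    have hq2 : q₂ = 0 := by simpa using h.2.2
    have := h2.1
    rw [hp2, hq2] at this
    obtain ⟨x, y, hxy⟩ := this
    simp at hxy

theorem par_dbl {X Y : ℚ} (hE : OnE X Y) {p₁ q₁ p₂ q₂ p₃ q₃ p₄ q₄ : ℤ} (h1 : Rep (pt X Y hE) p₁ q₁)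
    (h2 : Rep (pt X Y hE) p₂ q₂)
    (h3 : Rep (pt X Y hE + pt X Y hE) p₃ q₃) (h4 : Rep 0 p₄ q₄) : Par p₁ q₁ p₂ q₂ p₃ q₃ p₄ q₄ := by
  have e := rep_cross h1 h2
  obtain ⟨hq1, f1⟩ := rep_pt hE h1
  obtain ⟨hq2, f2⟩ := rep_pt hE h2
  obtain ⟨rfl, hp⟩ := rep_zero' h4
  have hY := hE.y_ne
  obtain ⟨l, hl⟩ : ∃ l : ℚ, l = (3 * X ^ 2 + 5) / (2 * Y) := ⟨_, rfl⟩
  have hl' : l * (2 * Y) = 3 * X ^ 2 + 5 := by rw [hl]; field_simp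
  obtain ⟨h5, h6⟩ := dbl_pt hE hl' rfl rfl
  rw [h6] at h3
  obtain ⟨hq3, f3⟩ := rep_pt h5 h3
  obtain ⟨x, rfl⟩ : ∃ x, X = 4 * x - 1 := ⟨(X + 1) / 4, by ring⟩
  have g1 : (p₁ : ℚ) = x * q₁ := by linarith
  have g2 : (p₂ : ℚ) = x * q₂ := by linarith
  have hE' : Y ^ 2 = 16 * (4 * x ^ 3 - 3 * x ^ 2 + 2 * x + 1) := by unfold OnE at hE; rw [hE]; ring
  have key : (4 * x ^ 3 - 3 * x ^ 2 + 2 * x + 1) * (p₃ : ℚ) = (x ^ 4 - x ^ 2 - 2 * x + 1) * q₃ := by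
    have k2 : l ^ 2 * (64 * (4 * x ^ 3 - 3 * x ^ 2 + 2 * x + 1)) = (48 * x ^ 2 - 24 * x + 8) ^ 2 := by
      linear_combination (l * 2 * Y + (48 * x ^ 2 - 24 * x + 8)) * hl' - 4 * l ^ 2 * hE'
    linear_combination (-(4 * x ^ 3 - 3 * x ^ 2 + 2 * x + 1) / 4 ) * f3 + (q₃ : ℚ) / 256 * k2
  refine par_of h3.1 h4.1 rfl rfl rfl ?_ ?_ ?_ ?_
  · have : (((p₁*p₂)^2 - (p₁*p₂)*(q₁*q₂) - (p₁*q₂+p₂*q₁)*(q₁*q₂) + (q₁*q₂)^2) * (p₃ * 0 + p₄ * q₃) : ℚ) =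
      (2*(p₁*q₂+p₂*q₁)*(p₁*p₂) - 3*(p₁*p₂)*(q₁*q₂) + (p₁*q₂+p₂*q₁)*(q₁*q₂) + (q₁*q₂)^2) * (p₃ * p₄) := by
      rw [g1, g2]
      linear_combination (-(q₁ * q₂) ^ 2 * p₄ : ℚ) * key
    exact_mod_cast this
  · rw [show p₁ * q₂ - p₂ * q₁ = 0 by linarith]; ring
  · rw [show p₁ * q₂ - p₂ * q₁ = 0 by linarith]; ring
  · right; left
    have : (2*(p₁*q₂+p₂*q₁)*(p₁*p₂) - 3*(p₁*p₂)*(q₁*q₂) + (p₁*q₂+p₂*q₁)*(q₁*q₂) + (q₁*q₂)^2 : ℚ) ≠ 0 := by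
      have : (2*(p₁*q₂+p₂*q₁)*(p₁*p₂) - 3*(p₁*p₂)*(q₁*q₂) + (p₁*q₂+p₂*q₁)*(q₁*q₂) + (q₁*q₂)^2 : ℚ)
        = (q₁ * q₂) ^ 2 * Y ^ 2 / 16 := by
        rw [g1, g2, hE']; ring
      rw [this]
      have a1 : (q₁ : ℚ) ≠ 0 := by exact_mod_cast hq1
      have a2 : (q₂ : ℚ) ≠ 0 := by exact_mod_cast hq2
      positivity
    exact_mod_cast this

theorem par_gen {X Y Z T : ℚ} (hE : OnE X Y) (hF : OnE Z T) (hXZ : X ≠ Z)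
    {p₁ q₁ p₂ q₂ p₃ q₃ p₄ q₄ : ℤ} (h1 : Rep (pt X Y hE) p₁ q₁)
    (h2 : Rep (pt Z T hF) p₂ q₂)
    (h3 : Rep (pt X Y hE + pt Z T hF) p₃ q₃) (h4 : Rep (pt X Y hE - pt Z T hF) p₄ q₄) :
    Par p₁ q₁ p₂ q₂ p₃ q₃ p₄ q₄ := by
  obtain ⟨hq1, f1⟩ := rep_pt hE h1
  obtain ⟨hq2, f2⟩ := rep_pt hF h2
  have hD : X - Z ≠ 0 := sub_ne_zero.mpr hXZ
  obtain ⟨l, hl⟩ : ∃ l : ℚ, l = (Y - T) / (X - Z) := ⟨_, rfl⟩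
  obtain ⟨m, hm⟩ : ∃ m : ℚ, m = (Y + T) / (X - Z) := ⟨_, rfl⟩
  have hl' : l * (X - Z) = Y - T := by rw [hl]; field_simp
  have hm' : m * (X - Z) = Y + T := by rw [hm]; field_simp
  obtain ⟨h5, h6⟩ := add_pt hE hF hXZ hl' rfl rfl
  obtain ⟨h7, h8⟩ := add_pt hE hF.neg hXZ (l := m) (by rw [hm']; ring) rfl rfl
  rw [h6] at h3
  rw [sub_eq_add_neg, neg_pt, h8] at h4
  obtain ⟨hq3, f3⟩ := rep_pt h5 h3
  obtain ⟨hq4, f4⟩ := rep_pt h7 h4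
  have hlm : l * m * (X - Z) = X ^ 2 + X * Z + Z ^ 2 + 5 := by
    apply mul_right_cancel₀ hD
    unfold OnE at hE hF
    linear_combination m * (X - Z) * hl' + (Y - T) * hm' + hE - hF
  have hs : (l ^ 2 + m ^ 2) * (X - Z) ^ 2 = 2 * (X ^ 3 + 5 * X + 22) + 2 * (Z ^ 3 + 5 * Z + 22) := by
    unfold OnE at hE hF
    linear_combination (l * (X - Z) + Y - T) * hl' + (m * (X - Z) + Y + T) * hm' + 2 * hE + 2 * hF
  obtain ⟨x, rfl⟩ : ∃ x, X = 4 * x - 1 := ⟨(X + 1) / 4, by ring⟩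
  obtain ⟨z, rfl⟩ : ∃ x, Z = 4 * x - 1 := ⟨(Z + 1) / 4, by ring⟩
  obtain ⟨v, hv⟩ : ∃ v, l ^ 2 = 4 * v - 1 + (4 * x - 1) + (4 * z - 1) := ⟨(l ^ 2 + 3 - 4 * x - 4 * z) / 4, by ring⟩
  obtain ⟨w, hw⟩ : ∃ v, m ^ 2 = 4 * v - 1 + (4 * x - 1) + (4 * z - 1) := ⟨(m ^ 2 + 3 - 4 * x - 4 * z) / 4, by ring⟩
  have g1 : (p₁ : ℚ) = x * q₁ := by linarith
  have g2 : (p₂ : ℚ) = z * q₂ := by linarith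
  have g3 : (p₃ : ℚ) = v * q₃ := by rw [hv] at f3; linarith
  have g4 : (p₄ : ℚ) = w * q₄ := by rw [hw] at f4; linarith
  have kB : (v + w) * (x - z) ^ 2 = 2 * (x + z) * (x * z) - 3 * (x * z) + (x + z) + 1 := by
    rw [hv, hw] at hs
    linear_combination hs / 64
  have kA : (v * w) * (x - z) ^ 2 = (x * z) ^ 2 - x * z - (x + z) + 1 := by
    have h9 : (l * m * (4 * x - 1 - (4 * z - 1))) ^ 2 = l ^ 2 * m ^ 2 * (4 * x - 4 * z) ^ 2 := by ring
    rw [hlm, hv, hw] at h9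
    linear_combination -h9 / 256 - (x + z - 3/4) * kB
  refine par_of h3.1 h4.1 rfl rfl rfl ?_ ?_ ?_ ?_
  · have : (((p₁*p₂)^2 - (p₁*p₂)*(q₁*q₂) - (p₁*q₂+p₂*q₁)*(q₁*q₂) + (q₁*q₂)^2) * (p₃ * q₄ + p₄ * q₃) : ℚ) =
      (2*(p₁*q₂+p₂*q₁)*(p₁*p₂) - 3*(p₁*p₂)*(q₁*q₂) + (p₁*q₂+p₂*q₁)*(q₁*q₂) + (q₁*q₂)^2) * (p₃ * p₄) := by
      rw [g1, g2, g3, g4]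
      linear_combination (-(q₁ * q₂) ^ 2 * q₃ * q₄ : ℚ) * ((v + w) * kA - v * w * kB)
    exact_mod_cast this
  · have : (((p₁*p₂)^2 - (p₁*p₂)*(q₁*q₂) - (p₁*q₂+p₂*q₁)*(q₁*q₂) + (q₁*q₂)^2) * (q₃ * q₄) : ℚ) =
      (p₁*q₂-p₂*q₁)^2 * (p₃ * p₄) := by
      rw [g1, g2, g3, g4]
      linear_combination (-(q₁ * q₂) ^ 2 * q₃ * q₄ : ℚ) * kA
    exact_mod_cast this
  · have : ((2*(p₁*q₂+p₂*q₁)*(p₁*p₂) - 3*(p₁*p₂)*(q₁*q₂) + (p₁*q₂+p₂*q₁)*(q₁*q₂) + (q₁*q₂)^2) * (q₃ * q₄) : ℚ) =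
      (p₁*q₂-p₂*q₁)^2 * (p₃ * q₄ + p₄ * q₃) := by
      rw [g1, g2, g3, g4]
      linear_combination (-(q₁ * q₂) ^ 2 * q₃ * q₄ : ℚ) * kB
    exact_mod_cast this
  · right; right
    have : (p₁*q₂-p₂*q₁ : ℚ) ≠ 0 := by
      have a1 : (q₁ : ℚ) ≠ 0 := by exact_mod_cast hq1
      have a2 : (q₂ : ℚ) ≠ 0 := by exact_mod_cast hq2
      have : (p₁*q₂-p₂*q₁ : ℚ) = q₁ * q₂ * (x - z) := by rw [g1, g2]; ring
      rw [this]
      have : x - z ≠ 0 := fun h => hD (by linarith)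
      positivity
    have h : p₁*q₂-p₂*q₁ ≠ 0 := by exact_mod_cast this
    positivity

theorem par {P Q : Pt} {p₁ q₁ p₂ q₂ p₃ q₃ p₄ q₄ : ℤ} (h1 : Rep P p₁ q₁) (h2 : Rep Q p₂ q₂)
    (h3 : Rep (P + Q) p₃ q₃) (h4 : Rep (P - Q) p₄ q₄) : Par p₁ q₁ p₂ q₂ p₃ q₃ p₄ q₄ := by
  rcases pt_cases P with rfl | ⟨X, Y, hE, rfl⟩
  · rw [zero_add] at h3
    have := h4.neg
    rw [zero_sub, neg_neg] at this
    exact par_zero h1 h2 h3 this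
  rcases pt_cases Q with rfl | ⟨Z, T, hF, rfl⟩
  · rw [add_zero] at h3
    rw [sub_zero] at h4
    exact (par_zero h2 h1 h3 h4).symm
  by_cases hXZ : X = Z
  · subst hXZ
    rcases hE.eq_or hF with h | h
    · subst h
      rw [sub_self] at h4
      exact par_dbl hE h1 h2 h3 h4
    · have e : pt X T hF = -pt X Y hE := by
        rw [neg_pt]; exact pt_ext _ _ rfl (by linarith)
      rw [e] at h2 h3 h4
      have h2' := h2.neg
      rw [neg_neg] at h2'
      rw [add_neg_cancel] at h3
      rw [sub_neg_eq_add] at h4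
      exact (par_dbl hE h1 h2' h4 h3).swap
  · exact par_gen hE hF hXZ h1 h2 h3 h4

end Cub

namespace Cub

noncomputable def N (P : Pt) : ℤ :=
  (exists_rep P).choose ^ 2 + (exists_rep P).choose_spec.choose ^ 2

theorem sq_eq_of_cross {p q p' q' : ℤ} (h : IsCoprime p q) (h' : IsCoprime p' q')
    (e : p * q' = p' * q) : p ^ 2 = p' ^ 2 := by
  have h1 : p ∣ p' := h.dvd_of_dvd_mul_right ⟨q', e.symm⟩
  have h2 : p' ∣ p := h'.dvd_of_dvd_mul_right ⟨q, e⟩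
  rw [← Int.natAbs_eq_iff_sq_eq]
  exact Int.natAbs_eq_of_dvd_dvd h1 h2

theorem N_eq {P : Pt} {p q : ℤ} (h : Rep P p q) : N P = p ^ 2 + q ^ 2 := by
  have h' := (exists_rep P).choose_spec.choose_spec
  have e := rep_cross h h'
  unfold N
  rw [sq_eq_of_cross h.1 h'.1 e, sq_eq_of_cross h.1.symm h'.1.symm (by linarith)]

theorem N_pos (P : Pt) : 1 ≤ N P := by
  obtain ⟨p, q, h⟩ := exists_rep P
  rw [N_eq h]
  have : p ^ 2 + q ^ 2 ≠ 0 := by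
    intro h0
    have hp : p = 0 := by nlinarith
    have hq : q = 0 := by nlinarith
    obtain ⟨x, y, hxy⟩ := h.1
    simp [hp, hq] at hxy
  have : 0 ≤ p ^ 2 + q ^ 2 := by positivity
  omega

theorem N_zero : N 0 = 1 := by rw [N_eq rep_zero]; norm_num

theorem N_neg (P : Pt) : N (-P) = N P := by
  obtain ⟨p, q, h⟩ := exists_rep P
  rw [N_eq h, N_eq h.neg]

theorem N_par_eq {P Q : Pt} {p₁ q₁ p₂ q₂ : ℤ} (h1 : Rep P p₁ q₁) (h2 : Rep Q p₂ q₂) :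
    ∃ k : ℤ, k ≠ 0 ∧ k ^ 2 * (N (P + Q) * N (P - Q)) =
    ((p₁*p₂)^2 - (p₁*p₂)*(q₁*q₂) - (p₁*q₂+p₂*q₁)*(q₁*q₂) + (q₁*q₂)^2 - (p₁*q₂-p₂*q₁)^2) ^ 2 +
    (2*(p₁*q₂+p₂*q₁)*(p₁*p₂) - 3*(p₁*p₂)*(q₁*q₂) + (p₁*q₂+p₂*q₁)*(q₁*q₂) + (q₁*q₂)^2) ^ 2 := by
  obtain ⟨p₃, q₃, h3⟩ := exists_rep (P + Q)
  obtain ⟨p₄, q₄, h4⟩ := exists_rep (P - Q)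
  obtain ⟨k, hk, a, b, c⟩ := par h1 h2 h3 h4
  refine ⟨k, hk, ?_⟩
  rw [N_eq h3, N_eq h4, a, b, c]; ring

theorem N_par_le {P Q : Pt} {p₁ q₁ p₂ q₂ : ℤ} (h1 : Rep P p₁ q₁) (h2 : Rep Q p₂ q₂) :
    N (P + Q) * N (P - Q) ≤
    ((p₁*p₂)^2 - (p₁*p₂)*(q₁*q₂) - (p₁*q₂+p₂*q₁)*(q₁*q₂) + (q₁*q₂)^2 - (p₁*q₂-p₂*q₁)^2) ^ 2 +
    (2*(p₁*q₂+p₂*q₁)*(p₁*p₂) - 3*(p₁*p₂)*(q₁*q₂) + (p₁*q₂+p₂*q₁)*(q₁*q₂) + (q₁*q₂)^2) ^ 2 := by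
  obtain ⟨k, hk, h⟩ := N_par_eq h1 h2
  rw [← h]
  have h1 := N_pos (P + Q)
  have h2 := N_pos (P - Q)
  have : 1 ≤ k ^ 2 := by
    have : 0 < k ^ 2 := by positivity
    omega
  have : 0 < N (P + Q) * N (P - Q) := by positivity
  nlinarith

theorem N_par (P Q : Pt) : N (P + Q) * N (P - Q) ≤ 61 * (N P * N Q) ^ 2 := by
  obtain ⟨p₁, q₁, h1⟩ := exists_rep P
  obtain ⟨p₂, q₂, h2⟩ := exists_rep Q
  refine (N_par_le h1 h2).trans ?_
  rw [N_eq h1, N_eq h2]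
  obtain ⟨s, hs⟩ : ∃ s, s = p₁ * p₂ := ⟨_, rfl⟩
  obtain ⟨t, ht⟩ : ∃ s, s = p₁ * q₂ + p₂ * q₁ := ⟨_, rfl⟩
  obtain ⟨u, hu⟩ : ∃ s, s = q₁ * q₂ := ⟨_, rfl⟩
  have hM : (p₁ ^ 2 + q₁ ^ 2) * (p₂ ^ 2 + q₂ ^ 2) = (s - u) ^ 2 + t ^ 2 := by
    rw [hs, ht, hu]; ring
  have hd : (p₁ * q₂ - p₂ * q₁) ^ 2 = t ^ 2 - 4 * (s * u) := by
    rw [hs, ht, hu]; ring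
  have hd0 : 0 ≤ t ^ 2 - 4 * (s * u) := by rw [← hd]; positivity
  rw [hM, hd, ← hs, ← ht, ← hu]
  have hsu : s ^ 2 + u ^ 2 ≤ (s - u) ^ 2 + t ^ 2 := by nlinarith [sq_nonneg (s + u), sq_nonneg (s - u)]
  have ht2 : t ^ 2 ≤ (s - u) ^ 2 + t ^ 2 := by nlinarith [sq_nonneg (s - u)]
  obtain ⟨M, hMM⟩ : ∃ M, M = (s - u) ^ 2 + t ^ 2 := ⟨_, rfl⟩
  rw [← hMM] at hsu ht2 ⊢
  have b1 : |s ^ 2 - s * u - t * u + u ^ 2 - (t ^ 2 - 4 * (s * u))| ≤ 5 * M := by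
    rw [abs_le]
    constructor <;> nlinarith [sq_nonneg (s + u), sq_nonneg (s - u), sq_nonneg (t - u), sq_nonneg (t + u), sq_nonneg t, sq_nonneg s, sq_nonneg u]
  have b2 : |2 * t * s - 3 * s * u + t * u + u ^ 2| ≤ 6 * M := by
    rw [abs_le]
    constructor <;> nlinarith [sq_nonneg (s + u), sq_nonneg (s - u), sq_nonneg (t - u), sq_nonneg (t + u), sq_nonneg (t - s), sq_nonneg (t + s), sq_nonneg t, sq_nonneg s, sq_nonneg u]
  have c1 := sq_le_sq' (abs_le.mp b1).1 (abs_le.mp b1).2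
  have c2 := sq_le_sq' (abs_le.mp b2).1 (abs_le.mp b2).2
  nlinarith

theorem rep_G : Rep G 0 1 := ⟨isCoprime_one_right, Or.inr ⟨_, _, onE_G, rfl, one_ne_zero, by norm_num⟩⟩

theorem N_G (P : Pt) : N (P + G) * N (P - G) ≤ 2 * N P ^ 2 := by
  obtain ⟨p, q, h1⟩ := exists_rep P
  refine (N_par_le h1 rep_G).trans ?_
  rw [N_eq h1]
  nlinarith [mul_nonneg (sq_nonneg p) (sq_nonneg (p - q)), mul_nonneg (sq_nonneg p) (sq_nonneg q)]

theorem N_dbl_aux {P : Pt} {p q : ℤ} (h : Rep P p q) : ∃ k : ℤ, k ≠ 0 ∧ k ∣ 53 ∧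
    k ^ 2 * N (P + P) = (p ^ 4 - p ^ 2 * q ^ 2 - 2 * p * q ^ 3 + q ^ 4) ^ 2 +
      (4 * p ^ 3 * q - 3 * p ^ 2 * q ^ 2 + 2 * p * q ^ 3 + q ^ 4) ^ 2 := by
  obtain ⟨p₃, q₃, h3⟩ := exists_rep (P + P)
  obtain ⟨k, hk, a, b, c⟩ := par h h h3 (by rw [sub_self]; exact rep_zero)
  have a' : p ^ 4 - p ^ 2 * q ^ 2 - 2 * p * q ^ 3 + q ^ 4 = k * p₃ := by linear_combination a
  have b' : 4 * p ^ 3 * q - 3 * p ^ 2 * q ^ 2 + 2 * p * q ^ 3 + q ^ 4 = k * q₃ := by linear_combination b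
  refine ⟨k, hk, ?_, ?_⟩
  · have d1 : k ∣ 53 * p ^ 8 := by
      refine ⟨-((-53*p^4+14*p^2*(2*p*q)-2*p^2*q^2-6*(2*p*q)^2-6*(2*p*q)*q^2) * p₃ +
        (-7*p^4-6*p^2*(2*p*q)+2*p^2*q^2-6*(2*p*q)^2+6*(2*p*q)*q^2) * q₃), ?_⟩
      linear_combination (-53*p^4+14*p^2*(2*p*q)-2*p^2*q^2-6*(2*p*q)^2-6*(2*p*q)*q^2) * (-a') -
        (-7*p^4-6*p^2*(2*p*q)+2*p^2*q^2-6*(2*p*q)^2+6*(2*p*q)*q^2) * b'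
    have d2 : k ∣ 53 * q ^ 8 := by
      refine ⟨-((-12*(2*p*q)^2+12*(2*p*q)*q^2-23*q^4) * p₃ +
        (6*p^2*(2*p*q)+3*p^2*q^2-5*(2*p*q)*q^2-30*q^4) * q₃), ?_⟩
      linear_combination (-12*(2*p*q)^2+12*(2*p*q)*q^2-23*q^4) * (-a') -
        (6*p^2*(2*p*q)+3*p^2*q^2-5*(2*p*q)*q^2-30*q^4) * b'
    obtain ⟨x, y, hxy⟩ := h.1.pow (m := 8) (n := 8)
    have : (53 : ℤ) = x * (53 * p ^ 8) + y * (53 * q ^ 8) := by linear_combination (-53) * hxy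
    rw [this]
    exact dvd_add (d1.mul_left _) (d2.mul_left _)
  · rw [a', b', N_eq h3]; ring

theorem N_dbl_le (P : Pt) : N (P + P) ≤ 5 * N P ^ 4 := by
  obtain ⟨p, q, h⟩ := exists_rep P
  obtain ⟨k, hk, -, e⟩ := N_dbl_aux h
  have h1 : N (P + P) ≤ k ^ 2 * N (P + P) := by
    have := N_pos (P + P)
    have : 0 < k ^ 2 := by positivity
    nlinarith
  refine h1.trans ?_
  rw [e, N_eq h]
  have e1 := sq_nonneg (-50 * q ^ 4 + 347 * p * q ^ 3 - 26 * p ^ 2 * q ^ 2 + 200 * p ^ 4)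
  have e2 := sq_nonneg (201 * q ^ 4 - 164 * p * q ^ 3 + 706 * p ^ 2 * q ^ 2 + 704 * p ^ 3 * q)
  have e3 := sq_nonneg (452575 * q ^ 4 + 472436 * p * q ^ 3 + 116462 * p ^ 2 * q ^ 2)
  have e4 := sq_nonneg (544983 * q ^ 4 + 369181 * p * q ^ 3)
  have e5 := sq_nonneg (q ^ 4)
  nlinarith only [e1, e2, e3, e4, e5]

theorem N_dbl_ge (P : Pt) : N P ^ 4 ≤ 2809 * N (P + P) := by
  obtain ⟨p, q, h⟩ := exists_rep P
  obtain ⟨k, hk, hd, e⟩ := N_dbl_aux h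
  have h1 : k ^ 2 * N (P + P) ≤ 2809 * N (P + P) := by
    have := N_pos (P + P)
    have h2 := Int.le_of_dvd (by norm_num) hd
    have h3 := Int.le_of_dvd (by norm_num) ((neg_dvd (a := k)).mpr hd)
    have : k ^ 2 ≤ 2809 := by nlinarith
    nlinarith
  refine le_trans ?_ h1
  rw [e, N_eq h]
  have e1 := sq_nonneg (9 * q ^ 4 + 4 * p * q ^ 3 - 56 * p ^ 2 * q ^ 2 + 40 * p ^ 3 * q)
  have e2 := sq_nonneg (-2 * q ^ 4 - 17 * p * q ^ 3 + 8 * p ^ 2 * q ^ 2)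
  have e3 := sq_nonneg (-14 * q ^ 4 + 19 * p * q ^ 3)
  have e4 := sq_nonneg (q ^ 4)
  nlinarith only [e1, e2, e3, e4]

end Cub

namespace Cub

theorem mulG_step {n : ℕ} {X Y : ℚ} (hn : ∃ h, n • G = pt X Y h) (l : ℚ) {X' Y' : ℚ} (hX : X ≠ -1)
    (hl : l * (X - -1) = Y - 4) (hX' : X' = l ^ 2 - X - -1) (hY' : Y' = -(Y + l * (X' - X))) :
    ∃ h, (n + 1) • G = pt X' Y' h := by
  obtain ⟨h, e⟩ := hn
  rw [succ_nsmul, e]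
  exact add_pt h onE_G hX hl hX' hY'

theorem mulG_one : ∃ h, 1 • G = pt (-1) 4 h := ⟨onE_G, one_nsmul _⟩

theorem mulG_two : ∃ h, 2 • G = pt 3 (-8) h := by
  rw [two_nsmul]
  exact dbl_pt onE_G (l := 1) (by norm_num) (by norm_num) (by norm_num)

theorem mulG_3 : ∃ h, 3 • G = pt (7) (20) h :=
  mulG_step mulG_two (-3) (by norm_num) (by norm_num) (by norm_num) (by norm_num)

theorem mulG_4 : ∃ h, 4 • G = pt (-2) (-2) h :=
  mulG_step mulG_3 (2) (by norm_num) (by norm_num) (by norm_num) (by norm_num)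

theorem mulG_5 : ∃ h, 5 • G = pt (39) (-244) h :=
  mulG_step mulG_4 (6) (by norm_num) (by norm_num) (by norm_num) (by norm_num)

theorem mulG_6 : ∃ h, 6 • G = pt (11/25) (616/125) h :=
  mulG_step mulG_5 (-31/5) (by norm_num) (by norm_num) (by norm_num) (by norm_num)

theorem mulG_7 : ∃ h, 7 • G = pt (79/81) (-3844/729) h :=
  mulG_step mulG_6 (29/45) (by norm_num) (by norm_num) (by norm_num) (by norm_num)

theorem mulG_8 : ∃ h, 8 • G = pt (353/16) (6673/64) h :=
  mulG_step mulG_7 (-169/36) (by norm_num) (by norm_num) (by norm_num) (by norm_num)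

theorem mulG_9 : ∃ h, 9 • G = pt (-3633/1681) (72260/68921) h :=
  mulG_step mulG_8 (713/164) (by norm_num) (by norm_num) (by norm_num) (by norm_num)

theorem mulG_10 : ∃ h, 10 • G = pt (35803/3721) (-7036072/226981) h :=
  mulG_step mulG_9 (6357/2501) (by norm_num) (by norm_num) (by norm_num) (by norm_num)

theorem mulG_11 : ∃ h, 11 • G = pt (129799/58081) (93202036/13997521) h :=
  mulG_step mulG_10 (-48439/14701) (by norm_num) (by norm_num) (by norm_num) (by norm_num)

theorem mulG_12 : ∃ h, 12 • G = pt (-82914/148225) (-248931334/57066625) h :=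
  mulG_step mulG_11 (76254/92785) (by norm_num) (by norm_num) (by norm_num) (by norm_num)

theorem mulG_13 : ∃ h, 13 • G = pt (26565479/73441) (136925670164/19902511) h :=
  mulG_step mulG_12 (-1980074/104335) (by norm_num) (by norm_num) (by norm_num) (by norm_num)

theorem mulG_14 : ∃ h, 14 • G = pt (-104429837/74805201) (2269008067528/646990183449) h :=
  mulG_step mulG_13 (44430539/2343879) (by norm_num) (by norm_num) (by norm_num) (by norm_num)

theorem mulG_15 : ∃ h, 15 • G = pt (2946871487/746874241) (-207305593356100/20411326132289) h :=
  mulG_step mulG_14 (294236777/236368521) (by norm_num) (by norm_num) (by norm_num) (by norm_num)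

theorem mulG_16 : ∃ h, 16 • G = pt (14955565953/2849851456) (2112253893180737/152136470127104) h :=
  mulG_step mulG_15 (-4176073793/1458931336) (by norm_num) (by norm_num) (by norm_num) (by norm_num)

theorem mulG_17 : ∃ h, 17 • G = pt (-740796896321/424479613441) (-780204018956578364/276557382228693761) h :=
  mulG_step mulG_16 (55022430849/34780797064) (by norm_num) (by norm_num) (by norm_num) (by norm_num)

theorem mulG_18 : ∃ h, 18 • G = pt (47470621379731/548584642225) (-327182217965384978504/406317444033579625) h :=
  mulG_step mulG_17 (4417132352089/482558801465) (by norm_num) (by norm_num) (by norm_num) (by norm_num)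

theorem N_16 : (2 : ℤ) ^ 68 ≤ N (16 • G) := by
  obtain ⟨h, e⟩ := mulG_16
  have : Rep (16 • G) (17805417409) (11399405824) := by
    refine ⟨?_, Or.inr ⟨_, _, h, e, by norm_num, by norm_num⟩⟩
    rw [Int.isCoprime_iff_gcd_eq_one]
    norm_num
  rw [N_eq this]
  norm_num

def tau : ℕ → ℚ
  | 3 => -1
  | 4 => 0
  | 6 => -1/5
  | 7 => -5/9
  | 8 => -9/4
  | 9 => 4/41
  | 10 => -205/61
  | 11 => -549/1205
  | 12 => -964/3465
  | 13 => -15785/1084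
  | 14 => 16531/354609
  | 15 => -2084409/1667069
  | 16 => -10521665/12865544
  | 17 => -14467064/250835585
  | 18 => 5635005129/200720215
  | _ => 0

theorem tau_spec {i : ℕ} (h3 : 3 ≤ i) (h5 : i ≠ 5) (h18 : i ≤ 18) {X Y t : ℚ} {h : OnE X Y}
    (hi : i • G = pt X Y h) (ht : t * (39 - X) = Y - 6 * X - 10) : t = tau i := by
  interval_cases i
  · obtain ⟨h', e⟩ := mulG_3
    obtain ⟨rfl, rfl⟩ := pt_inj (hi.symm.trans e)
    simp only [tau]; linarith
  · obtain ⟨h', e⟩ := mulG_4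
    obtain ⟨rfl, rfl⟩ := pt_inj (hi.symm.trans e)
    simp only [tau]; linarith
  · exact absurd rfl h5
  · obtain ⟨h', e⟩ := mulG_6
    obtain ⟨rfl, rfl⟩ := pt_inj (hi.symm.trans e)
    simp only [tau]; linarith
  · obtain ⟨h', e⟩ := mulG_7
    obtain ⟨rfl, rfl⟩ := pt_inj (hi.symm.trans e)
    simp only [tau]; linarith
  · obtain ⟨h', e⟩ := mulG_8
    obtain ⟨rfl, rfl⟩ := pt_inj (hi.symm.trans e)
    simp only [tau]; linarith
  · obtain ⟨h', e⟩ := mulG_9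
    obtain ⟨rfl, rfl⟩ := pt_inj (hi.symm.trans e)
    simp only [tau]; linarith
  · obtain ⟨h', e⟩ := mulG_10
    obtain ⟨rfl, rfl⟩ := pt_inj (hi.symm.trans e)
    simp only [tau]; linarith
  · obtain ⟨h', e⟩ := mulG_11
    obtain ⟨rfl, rfl⟩ := pt_inj (hi.symm.trans e)
    simp only [tau]; linarith
  · obtain ⟨h', e⟩ := mulG_12
    obtain ⟨rfl, rfl⟩ := pt_inj (hi.symm.trans e)
    simp only [tau]; linarith
  · obtain ⟨h', e⟩ := mulG_13
    obtain ⟨rfl, rfl⟩ := pt_inj (hi.symm.trans e)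
    simp only [tau]; linarith
  · obtain ⟨h', e⟩ := mulG_14
    obtain ⟨rfl, rfl⟩ := pt_inj (hi.symm.trans e)
    simp only [tau]; linarith
  · obtain ⟨h', e⟩ := mulG_15
    obtain ⟨rfl, rfl⟩ := pt_inj (hi.symm.trans e)
    simp only [tau]; linarith
  · obtain ⟨h', e⟩ := mulG_16
    obtain ⟨rfl, rfl⟩ := pt_inj (hi.symm.trans e)
    simp only [tau]; linarith
  · obtain ⟨h', e⟩ := mulG_17
    obtain ⟨rfl, rfl⟩ := pt_inj (hi.symm.trans e)
    simp only [tau]; linarith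
  · obtain ⟨h', e⟩ := mulG_18
    obtain ⟨rfl, rfl⟩ := pt_inj (hi.symm.trans e)
    simp only [tau]; linarith

end Cub

namespace Cub

theorem small_sq {X Y : ℚ} (h : OnE X Y) {p q : ℤ} (hq : q ≠ 0) (hr : (X + 1) * q = 4 * p) :
    IsSquare (q * (4 * p ^ 3 - 3 * p ^ 2 * q + 2 * p * q ^ 2 + q ^ 3)) := by
  rw [← Rat.isSquare_intCast_iff]
  refine ⟨q ^ 2 * Y / 4, ?_⟩
  obtain rfl : X = 4 * p / q - 1 := by
    have : (q : ℚ) ≠ 0 := by exact_mod_cast hq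
    field_simp; linarith
  have : (q : ℚ) ≠ 0 := by exact_mod_cast hq
  have e : (q : ℚ) ^ 2 * Y / 4 * (q ^ 2 * Y / 4) = q ^ 4 / 16 * Y ^ 2 := by ring
  rw [e, h]
  push_cast
  field_simp
  ring

theorem small_x : ∀ p ∈ Finset.Icc (-3 : ℤ) 3, ∀ q ∈ Finset.Icc (-3 : ℤ) 3, q ≠ 0 →
    p ^ 2 + q ^ 2 ≤ 15 → IsSquare (q * (4 * p ^ 3 - 3 * p ^ 2 * q + 2 * p * q ^ 2 + q ^ 3)) →
    p = 0 ∨ p = q ∨ p = 2 * q := by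
  decide +kernel

theorem base (P : Pt) (hN : N P ≤ 15) : ∃ n : ℤ, P = n • G := by
  rcases pt_cases P with rfl | ⟨X, Y, hE, rfl⟩
  · exact ⟨0, by simp⟩
  obtain ⟨p, q, hr⟩ := exists_rep (pt X Y hE)
  rw [N_eq hr] at hN
  obtain ⟨hq, he⟩ := rep_pt hE hr
  have hs := small_sq hE hq he
  have key := small_x p (Finset.mem_Icc.mpr ⟨by nlinarith, by nlinarith⟩) q
    (Finset.mem_Icc.mpr ⟨by nlinarith, by nlinarith⟩) hq hN hs
  have hq' : (q : ℚ) ≠ 0 := by exact_mod_cast hq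
  have fin : ∀ (n : ℕ) (X' Y' : ℚ), (∃ h, n • G = pt X' Y' h) → X = X' → ∃ n : ℤ, pt X Y hE = n • G := by
    rintro n X' Y' ⟨h, e⟩ rfl
    rcases hE.eq_or h with h1 | h1
    · exact ⟨n, by rw [natCast_zsmul, e]; exact pt_ext _ _ rfl h1⟩
    · exact ⟨-n, by rw [neg_zsmul, natCast_zsmul, e, neg_pt]; exact pt_ext _ _ rfl h1⟩
  rcases key with rfl | rfl | rfl
  · refine fin _ _ _ mulG_one ?_
    apply mul_right_cancel₀ hq'
    push_cast at he; linarith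
  · refine fin _ _ _ mulG_two ?_
    apply mul_right_cancel₀ hq'
    linarith
  · refine fin _ _ _ mulG_3 ?_
    apply mul_right_cancel₀ hq'
    push_cast at he; linarith

theorem gen_aux (n : ℕ) : ∀ P : Pt, N P ≤ n → ∃ m : ℤ, P = m • G := by
  induction n using Nat.strong_induction_on with
  | _ n ih =>
  intro P hP
  by_cases hN : N P ≤ 15
  · exact base P hN
  push Not at hN
  have step : ∀ Q : Pt, N Q < N P → ∃ m : ℤ, Q = m • G := by
    intro Q hQ
    have hp := N_pos Q
    refine ih (N Q).toNat (by omega) Q (by omega)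
  obtain ⟨Q, h | h⟩ := half P
  · have h1 := N_dbl_ge Q
    rw [← h] at h1
    obtain ⟨m, hm⟩ := step Q (by
      by_contra! hc
      have : N P ^ 4 ≤ N Q ^ 4 := pow_le_pow_left₀ (by omega) hc 4
      nlinarith [sq_nonneg (N P), mul_pos (show 0 < N P by omega) (show 0 < N P by omega), pow_le_pow_left₀ (by norm_num) hN.le 3])
    exact ⟨2 * m, by rw [h, hm, two_mul, add_zsmul]⟩
  · have claim : ∀ R S : Pt, R = S + S → N R ^ 2 ≤ 2 * N P ^ 2 → N S < N P := by
      intro R S hR hle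
      by_contra! hc
      have h1 := N_dbl_ge S
      rw [← hR] at h1
      have h2 : N P ^ 4 ≤ N S ^ 4 := pow_le_pow_left₀ (by omega) hc 4
      have h3 : (N P ^ 4) ^ 2 ≤ (2809 * N R) ^ 2 := pow_le_pow_left₀ (by positivity) (h2.trans h1) 2
      have h4 : (16 : ℤ) ^ 6 ≤ N P ^ 6 := pow_le_pow_left₀ (by norm_num) hN 6
      have h5 : N P ^ 6 * N P ^ 2 ≤ 2809 ^ 2 * (2 * N P ^ 2) := by nlinarith
      have h6 : 0 < N P ^ 2 := by have : 0 < N P := by omega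
                                  positivity
      nlinarith
    have hG := N_G P
    have p1 := N_pos (P + G)
    have p2 := N_pos (P - G)
    rcases le_total (N (P + G)) (N (P - G)) with hle | hle
    · obtain ⟨m, hm⟩ := step Q (claim (P + G) Q h (by nlinarith))
      exact ⟨2 * m - 1, by rw [eq_sub_of_add_eq h, hm, sub_zsmul, two_mul, add_zsmul, one_zsmul, sub_eq_add_neg]⟩
    · have h' : P - G = (Q - G) + (Q - G) := by
        rw [eq_sub_of_add_eq h]; abel
      obtain ⟨m, hm⟩ := step (Q - G) (claim (P - G) (Q - G) h' (by nlinarith))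
      exact ⟨2 * m + 1, by rw [eq_add_of_sub_eq h', hm, add_zsmul, two_mul, add_zsmul, one_zsmul]⟩

theorem gen (P : Pt) : ∃ m : ℤ, P = m • G := by
  have := N_pos P
  exact gen_aux (N P).toNat P (by omega)

theorem tau_ne {i j : ℕ} (hi : 3 ≤ i) (hi' : i ≤ 18) (hj : 3 ≤ j) (hj' : j ≤ 18) :
    tau i * tau j ≠ -1 := by
  have : ∀ i ∈ Finset.Icc 3 18, ∀ j ∈ Finset.Icc 3 18, tau i * tau j ≠ -1 := by
    decide +kernel
  exact this i (Finset.mem_Icc.mpr ⟨hi, hi'⟩) j (Finset.mem_Icc.mpr ⟨hj, hj'⟩)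

end Cub

namespace Cub

open Filter Topology

theorem tate (h : ℤ → ℝ) (c1 c2 C : ℝ)
    (hu : ∀ n, h (2 * n) ≤ 4 * h n + c1) (hl : ∀ n, 4 * h n - c2 ≤ h (2 * n))
    (hp : ∀ m n, h (m + n) + h (m - n) ≤ 2 * h m + 2 * h n + C) :
    ∃ A : ℝ, ∀ n : ℤ, A * n ^ 2 - c1 / 3 ≤ h n ∧ h n ≤ A * n ^ 2 + c2 / 3 := by
  let u : ℤ → ℕ → ℝ := fun n k => h (2 ^ k * n) / 4 ^ k
  have hs : ∀ n k, u n (k + 1) = h (2 * (2 ^ k * n)) / 4 ^ k / 4 := by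
    intro n k
    simp only [u]
    rw [show (2 : ℤ) ^ (k + 1) * n = 2 * (2 ^ k * n) by ring]
    rw [pow_succ]; field_simp
  have b1 : ∀ n k, u n k ≤ h n + c1 / 3 * (1 - 1 / 4 ^ k) := by
    intro n k
    induction k with
    | zero => simp [u]
    | succ k ih =>
      have h4 : (0 : ℝ) < 4 ^ k := by positivity
      have : h (2 * (2 ^ k * n)) / 4 ^ k ≤ 4 * u n k + c1 / 4 ^ k := by
        simp only [u]
        rw [mul_div_assoc', ← add_div]
        gcongr
        exact hu _
      rw [hs]
      have e : (1 : ℝ) / 4 ^ (k + 1) = 1 / 4 ^ k / 4 := by rw [pow_succ]; field_simp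
      rw [e]
      have e2 : c1 / 4 ^ k = c1 * (1 / 4 ^ k) := by ring
      rw [e2] at this
      linarith
  have b2 : ∀ n k, h n - c2 / 3 * (1 - 1 / 4 ^ k) ≤ u n k := by
    intro n k
    induction k with
    | zero => simp [u]
    | succ k ih =>
      have h4 : (0 : ℝ) < 4 ^ k := by positivity
      have : 4 * u n k - c2 / 4 ^ k ≤ h (2 * (2 ^ k * n)) / 4 ^ k := by
        simp only [u]
        rw [mul_div_assoc', ← sub_div]
        gcongr
        exact hl _
      rw [hs]
      have e : (1 : ℝ) / 4 ^ (k + 1) = 1 / 4 ^ k / 4 := by rw [pow_succ]; field_simp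
      rw [e]
      have e2 : c2 / 4 ^ k = c2 * (1 / 4 ^ k) := by ring
      rw [e2] at this
      linarith
  have hc : ∀ n, ∃ L, Tendsto (u n) atTop (𝓝 L) := by
    intro n
    refine cauchySeq_tendsto_of_complete (cauchySeq_of_le_geometric (1 / 4) (|c1| + |c2|) (by norm_num) ?_)
    intro k
    rw [Real.dist_eq, hs]
    have h4 : (0 : ℝ) < 4 ^ k := by positivity
    have e : u n k - h (2 * (2 ^ k * n)) / 4 ^ k / 4 = (4 * h (2 ^ k * n) - h (2 * (2 ^ k * n))) / 4 * (1 / 4) ^ k := by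
      simp only [u]; rw [one_div, inv_pow]; field_simp
    rw [e, abs_mul, abs_of_pos (show (0 : ℝ) < (1 / 4) ^ k by positivity)]
    gcongr
    have a1 := hu (2 ^ k * n)
    have a2 := hl (2 ^ k * n)
    have := le_abs_self c1
    have := le_abs_self c2
    have := abs_nonneg c1
    have := abs_nonneg c2
    rw [abs_le]
    constructor <;> linarith
  choose H hH using hc
  have H1 : ∀ n, H n ≤ h n + c1 / 3 := by
    intro n
    have ht : Tendsto (fun k : ℕ => h n + c1 / 3 * (1 - (1 / 4 : ℝ) ^ k)) atTop (𝓝 (h n + c1 / 3 * (1 - 0))) :=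
      ((tendsto_const_nhds.sub (tendsto_pow_atTop_nhds_zero_of_lt_one (by norm_num) (by norm_num))).const_mul _).const_add _
    have := le_of_tendsto_of_tendsto' (hH n) ht (fun k => by rw [one_div_pow]; exact b1 n k)
    linarith
  have H2 : ∀ n, h n - c2 / 3 ≤ H n := by
    intro n
    have ht : Tendsto (fun k : ℕ => h n - c2 / 3 * (1 - (1 / 4 : ℝ) ^ k)) atTop (𝓝 (h n - c2 / 3 * (1 - 0))) :=
      ((tendsto_const_nhds.sub (tendsto_pow_atTop_nhds_zero_of_lt_one (by norm_num) (by norm_num))).const_mul _).const_sub _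
    have := le_of_tendsto_of_tendsto' ht (hH n) (fun k => by rw [one_div_pow]; exact b2 n k)
    linarith
  have Hp : ∀ m n, H (m + n) + H (m - n) ≤ 2 * H m + 2 * H n := by
    intro m n
    have t1 := (hH (m + n)).add (hH (m - n))
    have t2 : Tendsto (fun k : ℕ => 2 * u m k + 2 * u n k + C * (1 / 4 : ℝ) ^ k) atTop
        (𝓝 (2 * H m + 2 * H n + C * 0)) :=
      (((hH m).const_mul 2).add ((hH n).const_mul 2)).add
        ((tendsto_pow_atTop_nhds_zero_of_lt_one (by norm_num) (by norm_num)).const_mul C)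
    have := le_of_tendsto_of_tendsto' t1 t2 (fun k => by
      have h4 : (0 : ℝ) < 4 ^ k := by positivity
      have := hp (2 ^ k * m) (2 ^ k * n)
      simp only [u]
      rw [← mul_add, ← mul_sub] at this
      rw [one_div, inv_pow, ← add_div, mul_div_assoc', mul_div_assoc', ← add_div, ← div_eq_mul_inv, ← add_div]
      gcongr)
    linarith
  have Hd : ∀ n, H (2 * n) = 4 * H n := by
    intro n
    have t1 : Tendsto (fun k => u n (k + 1)) atTop (𝓝 (H n)) := (tendsto_add_atTop_iff_nat 1).mpr (hH n)
    have t2 := (hH (2 * n)).div_const 4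
    have : (fun k => u n (k + 1)) = fun k => u (2 * n) k / 4 := by
      ext k
      rw [hs]; simp only [u]
      rw [show (2 : ℤ) * (2 ^ k * n) = 2 ^ k * (2 * n) by ring]
    rw [this] at t1
    have := tendsto_nhds_unique t1 t2
    linarith
  have He : ∀ m n, H (m + n) + H (m - n) = 2 * H m + 2 * H n := by
    intro m n
    refine le_antisymm (Hp m n) ?_
    have := Hp (m + n) (m - n)
    rw [show m + n + (m - n) = 2 * m by ring, show m + n - (m - n) = 2 * n by ring, Hd, Hd] at this
    linarith
  have H0 : H 0 = 0 := by have := Hd 0; simp at this; linarith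
  have Hn : ∀ n : ℕ, H n = n ^ 2 * H 1 ∧ H (n + 1) = (n + 1) ^ 2 * H 1 := by
    intro n
    induction n with
    | zero => simp [H0]
    | succ n ih =>
      obtain ⟨i1, i2⟩ := ih
      refine ⟨by push_cast; exact i2, ?_⟩
      have := He (n + 1) 1
      rw [add_sub_cancel_right, i1, i2] at this
      push_cast
      linarith
  refine ⟨H 1, fun n => ?_⟩
  have key : H n = n ^ 2 * H 1 := by
    obtain ⟨m, rfl | rfl⟩ := n.eq_nat_or_neg
    · exact_mod_cast (Hn m).1
    · have := He 0 m
      rw [zero_add, zero_sub, H0] at this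
      have h2 := (Hn m).1
      push_cast
      rw [neg_sq, ← h2]; linarith
  have := H1 n
  have := H2 n
  constructor <;> linarith

end Cub

namespace Cub

theorem lg_le {x : ℝ} (hx : 0 < x) (a b : ℕ) (h : x ^ a ≤ 2 ^ b) : a * Real.logb 2 x ≤ b := by
  have h1 := Real.logb_le_logb_of_le (b := 2) (by norm_num) (by positivity) h
  rw [Real.logb_pow, Real.logb_pow, Real.logb_self_eq_one (by norm_num)] at h1
  linarith

noncomputable def ht (n : ℤ) : ℝ := Real.logb 2 (N (n • G))

theorem N_posR (P : Pt) : (0 : ℝ) < N P := by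
  have := N_pos P
  exact_mod_cast this

theorem ht_bounds : ∃ A : ℝ, (68 - 23 / 6) / 256 ≤ A ∧
    ∀ n : ℤ, A * n ^ 2 - 7 / 9 ≤ ht n ∧ ht n ≤ A * n ^ 2 + 23 / 6 := by
  have l5 := lg_le (x := 5) (by norm_num) 3 7 (by norm_num)
  have l2809 := lg_le (x := 2809) (by norm_num) 2 23 (by norm_num)
  push_cast at l5 l2809
  obtain ⟨A, hA⟩ := tate ht (7 / 3) (23 / 2) (Real.logb 2 61) (by
    intro n
    have h1 : (N ((2 * n) • G) : ℝ) ≤ 5 * N (n • G) ^ 4 := by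
      have := N_dbl_le (n • G)
      rw [two_mul, add_zsmul]
      exact_mod_cast this
    have h2 := Real.logb_le_logb_of_le (b := 2) (by norm_num) (N_posR _) h1
    have hp := N_posR (n • G)
    rw [Real.logb_mul (by norm_num) (by positivity), Real.logb_pow] at h2
    unfold ht
    push_cast at h2
    linarith) (by
    intro n
    have h1 : (N (n • G) : ℝ) ^ 4 ≤ 2809 * N ((2 * n) • G) := by
      have := N_dbl_ge (n • G)
      rw [two_mul, add_zsmul]
      exact_mod_cast this
    have hp := N_posR (n • G)
    have hp2 := N_posR ((2 * n) • G)
    have h2 := Real.logb_le_logb_of_le (b := 2) (by norm_num) (by positivity) h1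
    rw [Real.logb_mul (by norm_num) (by positivity), Real.logb_pow] at h2
    unfold ht
    push_cast at h2
    linarith) (by
    intro m n
    have h1 : (N ((m + n) • G) : ℝ) * N ((m - n) • G) ≤ 61 * (N (m • G) * N (n • G)) ^ 2 := by
      have := N_par (m • G) (n • G)
      rw [add_zsmul, sub_zsmul, ← sub_eq_add_neg]
      exact_mod_cast this
    have hp1 := N_posR (m • G)
    have hp2 := N_posR (n • G)
    have hp3 := N_posR ((m + n) • G)
    have hp4 := N_posR ((m - n) • G)
    have h2 := Real.logb_le_logb_of_le (b := 2) (by norm_num) (by positivity) h1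
    rw [Real.logb_mul (by positivity) (by positivity), Real.logb_mul (by norm_num) (by positivity),
      Real.logb_pow, Real.logb_mul (by positivity) (by positivity)] at h2
    unfold ht
    push_cast at h2
    linarith)
  refine ⟨A, ?_, fun n => ⟨by linarith [(hA n).1], by linarith [(hA n).2]⟩⟩
  have h16 := (hA 16).2
  have : (68 : ℝ) ≤ ht 16 := by
    have h1 : (2 : ℝ) ^ 68 ≤ N ((16 : ℤ) • G) := by
      have := N_16
      rw [← natCast_zsmul] at this
      exact_mod_cast this
    have h2 := Real.logb_le_logb_of_le (b := 2) (by norm_num) (by positivity) h1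
    rw [Real.logb_pow, Real.logb_self_eq_one (by norm_num)] at h2
    unfold ht
    push_cast at h2
    linarith
  push_cast at h16
  linarith

def ff (t : ℚ) : ℚ := t ^ 4 - 24 * t ^ 3 - 18 * t ^ 2 - 8 * t + 1

def Phi (p q : ℤ) : ℤ := (10 * p ^ 2 + 2 * p * q - 4 * q ^ 2) ^ 2 + (p ^ 2 - 12 * p * q - q ^ 2) ^ 2

theorem Phi_lo (p q : ℤ) : 33 * (p ^ 2 + q ^ 2) ^ 2 ≤ 2 * Phi p q := by
  unfold Phi
  nlinarith only [sq_nonneg (q ^ 2 + 32 * p * q + 338 * p ^ 2), sq_nonneg (1344 * q ^ 2 + 10729 * p * q),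
    sq_nonneg (q ^ 2)]

theorem Phi_hi (p q : ℤ) : 2 * Phi p q ≤ 203 * (p ^ 2 + q ^ 2) ^ 2 := by
  unfold Phi
  nlinarith only [sq_nonneg (2 * q ^ 2 - 16 * p * q + p ^ 2), sq_nonneg (12 * q ^ 2 + 7 * p * q),
    sq_nonneg (q ^ 2)]

theorem no_root4 : ∀ p q : ZMod 5, p ^ 4 - 24 * p ^ 3 * q - 18 * p ^ 2 * q ^ 2 - 8 * p * q ^ 3 + q ^ 4 = 0 →
    p = 0 ∧ q = 0 := by decide

theorem ff_ne {t : ℚ} : ff t ≠ 0 := by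
  intro h
  have hq : (t.den : ℚ) ≠ 0 := by exact_mod_cast t.den_nz
  have ht : t * t.den = t.num := Rat.mul_den_eq_num t
  have h1 : (t.num ^ 4 - 24 * t.num ^ 3 * t.den - 18 * t.num ^ 2 * t.den ^ 2 - 8 * t.num * t.den ^ 3 + t.den ^ 4 : ℚ) = 0 := by
    rw [← ht]
    unfold ff at h
    linear_combination (t.den : ℚ) ^ 4 * h
  have h2 : (t.num ^ 4 - 24 * t.num ^ 3 * t.den - 18 * t.num ^ 2 * t.den ^ 2 - 8 * t.num * t.den ^ 3 + t.den ^ 4 : ℤ) = 0 := by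
    exact_mod_cast h1
  have h3 := congrArg (Int.cast : ℤ → ZMod 5) h2
  push_cast at h3
  obtain ⟨a, b⟩ := no_root4 _ _ h3
  rw [ZMod.intCast_zmod_eq_zero_iff_dvd] at a
  rw [ZMod.natCast_eq_zero_iff] at b
  have := Nat.dvd_gcd (Int.natAbs_dvd_natAbs.mpr a) b
  rw [Nat.Coprime.gcd_eq_one t.reduced] at this
  norm_num at this

theorem pair (t y : ℚ) (hy : y ^ 2 = ff t) {p q : ℤ} (hpq : IsCoprime p q) (hq : q ≠ 0) (htq : t * q = p) :
    ∃ (X Y X' Y' : ℚ) (h : OnE X Y) (h' : OnE X' Y'),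
      t * (39 - X) = Y - 6 * X - 10 ∧ t * (39 - X') = Y' - 6 * X' - 10 ∧
      pt X Y h + pt X' Y' h' = 5 • G ∧
      ∃ k : ℤ, 1 ≤ k ^ 2 ∧ k ^ 2 ≤ 16 ∧ k ^ 2 * (N (pt X Y h) * N (pt X' Y' h')) = Phi p q := by
  have on : ∀ z : ℚ, z ^ 2 = ff t → OnE ((z + t ^ 2 - 12 * t - 3) / 2)
      (t * (39 - (z + t ^ 2 - 12 * t - 3) / 2) + 6 * ((z + t ^ 2 - 12 * t - 3) / 2) + 10) := by
    intro z hz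
    unfold OnE
    unfold ff at hz
    obtain ⟨X, hX⟩ : ∃ X, X = (z + t ^ 2 - 12 * t - 3) / 2 := ⟨_, rfl⟩
    rw [← hX]
    obtain rfl : z = 2 * X - t ^ 2 + 12 * t + 3 := by rw [hX]; ring
    linear_combination (39 - X) / 4 * hz
  have hy' : (-y) ^ 2 = ff t := by rw [neg_sq, hy]
  have hy0 : y ≠ 0 := by
    rintro rfl
    exact ff_ne (t := t) (by rw [← hy]; ring)
  refine ⟨_, _, _, _, on y hy, on (-y) hy', by ring, by ring, ?_, ?_⟩
  · obtain ⟨h5, e5⟩ := mulG_5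
    rw [e5]
    obtain ⟨h6, e6⟩ := add_pt (on y hy) (on (-y) hy') (by intro h; apply hy0; linarith) (l := 6 - t)
      (x₃ := 39) (y₃ := -244) (by ring) (by ring) (by ring)
    rw [e6]
  · obtain ⟨p₃, q₃, h3⟩ := exists_rep (pt _ _ (on y hy))
    obtain ⟨p₄, q₄, h4⟩ := exists_rep (pt _ _ (on (-y) hy'))
    have f3 := (rep_pt _ h3).2
    have f4 := (rep_pt _ h4).2
    obtain ⟨v, hv⟩ : ∃ v, v = ((y + t ^ 2 - 12 * t - 3) / 2 + 1) / 4 := ⟨_, rfl⟩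
    obtain ⟨w, hw⟩ : ∃ v, v = ((-y + t ^ 2 - 12 * t - 3) / 2 + 1) / 4 := ⟨_, rfl⟩
    have g3 : (p₃ : ℚ) = v * q₃ := by rw [hv]; linarith
    have g4 : (p₄ : ℚ) = w * q₄ := by rw [hw]; linarith
    have hb : 4 * (v + w) = t ^ 2 - 12 * t - 1 := by rw [hv, hw]; ring
    have ha : 4 * (v * w) = 10 * t ^ 2 + 2 * t := by
      rw [hv, hw]; unfold ff at hy; linear_combination (-1 / 16) * hy
    obtain ⟨k, ka, kb, kc⟩ := prim (a := 10 * p ^ 2 + 2 * p * q) (b := p ^ 2 - 12 * p * q - q ^ 2) (c := 4 * q ^ 2)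
      h3.1 h4.1 (by
        have : ((10 * p ^ 2 + 2 * p * q) * (p₃ * q₄ + p₄ * q₃) : ℚ) = (p ^ 2 - 12 * p * q - q ^ 2) * (p₃ * p₄) := by
          rw [g3, g4, ← htq]
          linear_combination (q : ℚ) ^ 2 * q₃ * q₄ * (v * w * hb - (v + w) * ha)
        exact_mod_cast this) (by
        have : ((10 * p ^ 2 + 2 * p * q) * (q₃ * q₄) : ℚ) = 4 * q ^ 2 * (p₃ * p₄) := by
          rw [g3, g4, ← htq]
          linear_combination -(q : ℚ) ^ 2 * q₃ * q₄ * ha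
        exact_mod_cast this) (by
        have : ((p ^ 2 - 12 * p * q - q ^ 2) * (q₃ * q₄) : ℚ) = 4 * q ^ 2 * (p₃ * q₄ + p₄ * q₃) := by
          rw [g3, g4, ← htq]
          linear_combination -(q : ℚ) ^ 2 * q₃ * q₄ * hb
        exact_mod_cast this)
    have k0 : k ≠ 0 := by
      rintro rfl
      have : 4 * q ^ 2 ≠ 0 := by positivity
      simp at kc
      exact hq kc
    have k4 : k ∣ 4 := by
      obtain ⟨x, z, hxz⟩ := hpq.pow (m := 3) (n := 2)
      have d1 : k ∣ p ^ 2 - 12 * p * q - q ^ 2 := ⟨_, kb⟩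
      have d2 : k ∣ 4 * q ^ 2 := ⟨_, kc⟩
      have : (4 : ℤ) = (p ^ 2 - 12 * p * q - q ^ 2) * (x * (4 * p + 48 * q)) +
          4 * q ^ 2 * (z + x * (p + 144 * p + 12 * q)) := by
        linear_combination (-4) * hxz
      rw [this]
      exact dvd_add (d1.mul_right _) (d2.mul_right _)
    refine ⟨k, ?_, ?_, ?_⟩
    · have : 0 < k ^ 2 := by positivity
      omega
    · have h2 := Int.le_of_dvd (by norm_num) k4
      have h3 := Int.le_of_dvd (by norm_num) ((neg_dvd (a := k)).mpr k4)
      nlinarith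
    · rw [N_eq h3, N_eq h4, Phi, ka, kb, kc]; ring

theorem index (t y : ℚ) (hy : y ^ 2 = ff t) {p q : ℤ} (hpq : IsCoprime p q) (hq : q ≠ 0) (htq : t * q = p) :
    ∃ i : ℕ, 3 ≤ i ∧ i ≠ 5 ∧ (∃ X Y h, i • G = pt X Y h ∧ t * (39 - X) = Y - 6 * X - 10) ∧
      ∃ k : ℤ, 1 ≤ k ^ 2 ∧ k ^ 2 ≤ 16 ∧ k ^ 2 * (N ((i : ℤ) • G) * N ((5 - i : ℤ) • G)) = Phi p q := by
  obtain ⟨X, Y, X', Y', h, h', e, e', hs, k, k1, k2, k3⟩ := pair t y hy hpq hq htq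
  obtain ⟨m, hm⟩ := gen (pt X Y h)
  have hm' : pt X' Y' h' = (5 - m) • G := by
    rw [sub_zsmul, ← hm, eq_sub_of_add_eq' hs]
    rw [sub_eq_add_neg]
    rfl
  have five : ∀ i : ℕ, ∀ X Y h, i • G = pt X Y h → t * (39 - X) = Y - 6 * X - 10 → i ≠ 5 := by
    rintro i X Y h h1 h2 rfl
    obtain ⟨h5, e5⟩ := mulG_5
    obtain ⟨rfl, rfl⟩ := pt_inj (h1.symm.trans e5)
    norm_num at h2
  by_cases h3 : 3 ≤ m
  · obtain ⟨i, rfl⟩ := Int.eq_ofNat_of_zero_le (show 0 ≤ m by omega)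
    have hi : i • G = pt X Y h := by rw [hm, natCast_zsmul]
    refine ⟨i, by omega, five i _ _ _ hi e, ⟨X, Y, h, hi, e⟩, k, k1, k2, ?_⟩
    rw [← hm, ← hm', k3]
  · obtain ⟨i, hi0⟩ := Int.eq_ofNat_of_zero_le (show 0 ≤ 5 - m by omega)
    have hi : i • G = pt X' Y' h' := by rw [hm', hi0, natCast_zsmul]
    refine ⟨i, by omega, five i _ _ _ hi e', ⟨X', Y', h', hi, e'⟩, k, k1, k2, ?_⟩
    rw [← hi0, ← hm', show (5 - (5 - m)) = m by ring, ← hm, ← k3]; ring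

theorem cmp {i j : ℕ} {p q p' q' : ℤ} (hM : p' ^ 2 + q' ^ 2 = p ^ 2 + q ^ 2) {k l : ℤ}
    (hk : 1 ≤ k ^ 2) (hl' : l ^ 2 ≤ 16)
    (ek : k ^ 2 * (N ((i : ℤ) • G) * N ((5 - i : ℤ) • G)) = Phi p q)
    (el : l ^ 2 * (N ((j : ℤ) • G) * N ((5 - j : ℤ) • G)) = Phi p' q') :
    ht i + ht (5 - i) ≤ ht j + ht (5 - j) + 20 / 3 := by
  have a1 := Phi_hi p q
  have a2 := Phi_lo p' q'
  rw [hM] at a2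
  have n1 := N_pos ((i : ℤ) • G)
  have n2 := N_pos ((5 - i : ℤ) • G)
  have n3 := N_pos ((j : ℤ) • G)
  have n4 := N_pos ((5 - j : ℤ) • G)
  have m1 : 0 < N ((i : ℤ) • G) * N ((5 - i : ℤ) • G) := by positivity
  have m2 : 0 < N ((j : ℤ) • G) * N ((5 - j : ℤ) • G) := by positivity
  have b1 : N ((i : ℤ) • G) * N ((5 - i : ℤ) • G) ≤ Phi p q := by rw [← ek]; nlinarith
  have b2 : Phi p' q' ≤ 16 * (N ((j : ℤ) • G) * N ((5 - j : ℤ) • G)) := by rw [← el]; nlinarith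
  have c : N ((i : ℤ) • G) * N ((5 - i : ℤ) • G) ≤ 99 * (N ((j : ℤ) • G) * N ((5 - j : ℤ) • G)) := by
    nlinarith
  have c' : (N ((i : ℤ) • G) * N ((5 - i : ℤ) • G) : ℝ) ≤ 99 * (N ((j : ℤ) • G) * N ((5 - j : ℤ) • G)) := by
    exact_mod_cast c
  have q1 := N_posR ((i : ℤ) • G)
  have q2 := N_posR ((5 - i : ℤ) • G)
  have q3 := N_posR ((j : ℤ) • G)
  have q4 := N_posR ((5 - j : ℤ) • G)
  have h2 := Real.logb_le_logb_of_le (b := 2) (by norm_num) (by positivity) c'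
  rw [Real.logb_mul (by positivity) (by positivity), Real.logb_mul (by norm_num) (by positivity),
      Real.logb_mul (by positivity) (by positivity)] at h2
  have l99 := lg_le (x := 99) (by norm_num) 3 20 (by norm_num)
  push_cast at l99
  unfold ht
  linarith

theorem small {A : ℝ} (hA : (68 - 23 / 6) / 256 ≤ A)
    (hb : ∀ n : ℤ, A * n ^ 2 - 7 / 9 ≤ ht n ∧ ht n ≤ A * n ^ 2 + 23 / 6) {i j : ℕ} (hj : 3 ≤ j)
    (hij : j < i) (hc : ht i + ht (5 - i) ≤ ht j + ht (5 - j) + 20 / 3) : i ≤ 18 := by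
  by_contra! h
  have h1 := (hb i).1
  have h2 := (hb (5 - i)).1
  have h3 := (hb j).2
  have h4 := (hb (5 - j)).2
  have hD : (32 : ℤ) ≤ (i - j) * (i + j - 5) := by
    by_cases hd : i = j + 1
    · subst hd; push_cast; ring_nf; omega
    · have : (2 : ℤ) ≤ i - j := by omega
      have : (17 : ℤ) ≤ i + j - 5 := by omega
      nlinarith
  have hD' : (32 : ℝ) ≤ (i - j) * (i + j - 5) := by exact_mod_cast hD
  push_cast at h1 h2 h3 h4
  nlinarith

theorem no_t (t y z : ℚ) (h0 : t ≠ 0) (hy : y ^ 2 = ff t) (hz : z ^ 2 = ff (-1 / t)) : False := by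
  have hq : (t.den : ℤ) ≠ 0 := by exact_mod_cast t.den_nz
  have hp : t.num ≠ 0 := Rat.num_ne_zero.mpr h0
  have hcop : IsCoprime t.num (t.den : ℤ) := Int.isCoprime_iff_gcd_eq_one.mpr t.reduced
  have htq : t * (t.den : ℤ) = t.num := by exact_mod_cast Rat.mul_den_eq_num t
  obtain ⟨i, i3, i5, ⟨X, Y, h, ei, ti⟩, k, k1, k2, ek⟩ := index t y hy hcop hq htq
  obtain ⟨j, j3, j5, ⟨X', Y', h', ej, tj⟩, l, l1, l2, el⟩ := index (-1 / t) z hz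
    (p := -(t.den : ℤ)) (q := t.num) hcop.symm.neg_left hp (by rw [← htq]; push_cast; field_simp)
  obtain ⟨A, hA, hb⟩ := ht_bounds
  have ci := cmp (i := i) (j := j) (by ring) k1 l2 ek el
  have cj := cmp (i := j) (j := i) (by ring) l1 k2 el ek
  have fin : i ≤ 18 → j ≤ 18 → False := by
    intro hi hj
    have e1 := tau_spec i3 i5 hi ei ti
    have e2 := tau_spec j3 j5 hj ej tj
    apply tau_ne i3 hi j3 hj
    rw [← e1, ← e2]; field_simp
  rcases lt_trichotomy i j with hij | hij | hij
  · have := small hA hb i3 hij cj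
    exact fin (by omega) this
  · subst hij
    obtain ⟨rfl, rfl⟩ := pt_inj (ei.symm.trans ej)
    have hX : X = 39 := by
      have h1 : (t - -1 / t) * (39 - X) = 0 := by linarith
      rcases mul_eq_zero.mp h1 with h1 | h1
      · field_simp at h1
        nlinarith
      · linarith
    subst hX
    have hY : Y = 244 := by linarith
    subst hY
    obtain ⟨h5, e5⟩ := mulG_5
    have e : ((i + 5 : ℕ) : ℤ) • G = 0 := by
      rw [natCast_zsmul, add_nsmul, ei, e5, ← neg_eq_iff_add_eq_zero, neg_pt]
    have := (hb ((i + 5 : ℕ) : ℤ)).1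
    unfold ht at this
    rw [e, N_zero] at this
    simp at this
    have i3' : (3 : ℝ) ≤ i := by exact_mod_cast i3
    nlinarith
  · have := small hA hb j3 hij ci
    exact fin this (by omega)

end Cub

theorem Cub.reduce (d u w : ℚ) (h1 : (4*d^2-4*d+1)*w^2 - (d^3-2*d+1)*w + d^3-2*d^2+d = 0)
  (h2 : (2*d-1)*u^2-(d^3+d^2-d)*u+d^3-d^2=0) (hd0 : d ≠ 0) (hd1 : d - 1 ≠ 0) (ht : 2*d-1 ≠ 0) : False := by
  refine Cub.no_t (2*d-1) (4*(2*(2*d-1)^2*w - (d^3-2*d+1))/(d-1)) (4*(2*(2*d-1)*u-(d^3+d^2-d))/d/(2*d-1)^2) ht ?_ ?_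
  · rw [div_pow, div_eq_iff (pow_ne_zero 2 hd1)]
    unfold Cub.ff
    linear_combination 64*(2*d-1)^2*h1
  · have : Cub.ff (-1/(2*d-1)) = ((2*d-1)^4+8*(2*d-1)^3-18*(2*d-1)^2+24*(2*d-1)+1)/((2*d-1)^2)^2 := by
      unfold Cub.ff
      generalize 2*d-1 = t at ht ⊢
      field_simp
      ring
    rw [this, div_pow]
    congr 1
    rw [div_pow, div_eq_iff (pow_ne_zero 2 hd0)]
    linear_combination 64*(2*d-1)*h2

/-- The only rational points on the affine space curve (graph N3H3) given by
`(4d² - 4d + 1)w² - (d³ - 2d + 1)w + d³ - 2d² + d = 0` and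
`(2d - 1)u² - (d³ + d² - d)u + d³ - d² = 0` are the five listed triples
`(d, u, w)`. -/
theorem stmt_15 :
    {p : ℚ × ℚ × ℚ |
        (4 * p.1 ^ 2 - 4 * p.1 + 1) * p.2.2 ^ 2 -
            (p.1 ^ 3 - 2 * p.1 + 1) * p.2.2 +
            p.1 ^ 3 - 2 * p.1 ^ 2 + p.1 = 0 ∧
        (2 * p.1 - 1) * p.2.1 ^ 2 - (p.1 ^ 3 + p.1 ^ 2 - p.1) * p.2.1 +
            p.1 ^ 3 - p.1 ^ 2 = 0} =
      ({(1/2, 1, 1), (1, 0, 0), (1, 1, 0), (0, 0, 0), (0, 0, 1)} :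
        Set (ℚ × ℚ × ℚ)) := by
  ext ⟨d, u, w⟩
  simp only [Set.mem_setOf_eq, Set.mem_insert_iff, Set.mem_singleton_iff, Prod.mk.injEq]
  constructor
  · rintro ⟨h1, h2⟩
    by_cases hd0 : d = 0
    · subst hd0
      have hu : u = 0 := by
        have : u^2 = 0 := by linear_combination -h2
        exact pow_eq_zero_iff (two_ne_zero) |>.1 this
      have hw : w * (w - 1) = 0 := by linear_combination h1
      rcases mul_eq_zero.1 hw with h | h
      · simp [hu, h]
      · have : w = 1 := by linarith
        simp [hu, this]
    by_cases hd1 : d - 1 = 0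
    · have hd : d = 1 := by linarith
      subst hd
      have hw : w = 0 := by
        have : w^2 = 0 := by linear_combination h1
        exact pow_eq_zero_iff (two_ne_zero) |>.1 this
      have hu : u * (u - 1) = 0 := by linear_combination h2
      rcases mul_eq_zero.1 hu with h | h
      · simp [hw, h]
      · have : u = 1 := by linarith
        simp [hw, this]
    by_cases ht : 2*d-1 = 0
    · have hd : d = 1/2 := by linarith
      subst hd
      left
      refine ⟨rfl, ?_, ?_⟩
      · linear_combination 8*h2
      · linear_combination -8*h1
    · exact (Cub.reduce d u w h1 h2 hd0 hd1 ht).elim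
  · rintro (⟨rfl, rfl, rfl⟩ | ⟨rfl, rfl, rfl⟩ | ⟨rfl, rfl, rfl⟩ | ⟨rfl, rfl, rfl⟩ | ⟨rfl, rfl, rfl⟩) <;> norm_num
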